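/- arXiv:1704.03898 — 2 statements merged into one kernel-verified Lean document; each statement's English description precedes it below -/
import Mathlib

section
/- (Pigeonhole for the Milliken space) Let k < ω, let U be a finite strong subtree of 2^{<ω} with k levels, and let T be an infinite strong subtree of 2^{<ω} such that r_{k+1}[U,T] is nonempty. Then for each coloring of r_{k+1}[U,T] into finitely many colors, there is an infinite strong subtree S of T with r_k(S) = U such that all members of r_{k+1}[U,S] have the same color. -/
/-- The downward closure (set of all initial segments) of a set of nodes of `2^{<ω}`. -/
def downcl (S : Set (List Bool)) : Set (List Bool) := {u | ∃ t ∈ S, u <+: t}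

/-- A node `s` splits in `S` if both of its immediate extensions lie in the downward closure
of `S`, i.e. both are extended by nodes of `S`. -/
def Splits (S : Set (List Bool)) (s : List Bool) : Prop :=
  s ++ [false] ∈ downcl S ∧ s ++ [true] ∈ downcl S

/-- `S` is a strong subtree of `2^{<ω}` witnessed by the set of levels `L`:
`S` equals the union of its level sets at levels in `L` (every node of `S` has length in `L`,
and every node of the downward closure of `S` at a level in `L` belongs to `S`), every node
of `S` splits into both immediate extensions inside `S`, no node splits at a level outside
`L`, and every level in `L` is the level of some node of `S`. -/
def IsStrongTree (S : Set (List Bool)) (L : Set ℕ) : Prop :=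
  S.Nonempty ∧
  (∀ s ∈ S, s.length ∈ L) ∧
  (∀ s ∈ downcl S, s.length ∈ L → s ∈ S) ∧
  (∀ s ∈ S, Splits S s) ∧
  (∀ s ∈ downcl S, Splits S s → s.length ∈ L) ∧
  (∀ l ∈ L, ∃ s ∈ S, s.length = l)

/-- An infinite strong subtree of `2^{<ω}`: one witnessed by an infinite set of levels. -/
def IsInfStrongTree (S : Set (List Bool)) : Prop :=
  ∃ L : Set ℕ, L.Infinite ∧ IsStrongTree S L

/-- `S` is a finite strong tree witnessed by the finite set of levels `L`: every node of `S`
has length in `L`, every node of the downward closure of `S` at a level in `L` belongs to `S`,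
every node of `S` at a non-maximal level splits into both immediate extensions inside `S`,
no node splits at a level outside `L`, and every level of `L` is realized. -/
def IsFinStrongTree (S : Set (List Bool)) (L : Finset ℕ) : Prop :=
  S.Nonempty ∧
  (∀ s ∈ S, s.length ∈ L) ∧
  (∀ s ∈ downcl S, s.length ∈ (L : Set ℕ) → s ∈ S) ∧
  (∀ s ∈ S, (∃ l ∈ L, s.length < l) → Splits S s) ∧
  (∀ s ∈ downcl S, Splits S s → s.length ∈ L) ∧
  (∀ l ∈ L, ∃ s ∈ S, s.length = l)

/-- `rk k T`: the set of nodes of `T` with fewer than `k` splitting nodes of `T` strictly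
below them (for a strong tree, every node of `T` is a splitting node of `T`, so these are
the proper initial segments of `t` lying in `T`); this is the first `k` levels of `T`. -/
def rk (k : ℕ) (T : Set (List Bool)) : Set (List Bool) :=
  {t ∈ T | {s | s ∈ T ∧ s <+: t ∧ s ≠ t}.ncard < k}

section UltrafilterRamsey

open Filter

attribute [local instance] Ultrafilter.semigroup

/-- A compact right topological semigroup contains an idempotent which is minimal for the
natural partial order on idempotents. -/
theorem exists_minimal_idempotent {M : Type*} [Nonempty M] [Semigroup M] [TopologicalSpace M]
    [CompactSpace M] [T2Space M] (hc : ∀ r : M, Continuous (· * r)) :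
    ∃ w : M, w * w = w ∧ ∀ q : M, q * q = q → w * q = q → q * w = q → q = w := by
  let I : Set (Set M) := {N | IsClosed N ∧ N.Nonempty ∧ ∀ m, ∀ n ∈ N, m * n ∈ N}
  obtain ⟨N, hN⟩ : ∃ N, Minimal (· ∈ I) N := by
    refine zorn_superset _ fun c hcs hch => ?_
    refine ⟨⋂₀ c, ⟨isClosed_sInter fun t ht => (hcs ht).1, ?_, fun m n hn => ?_⟩,
      fun s hs => Set.sInter_subset_of_mem hs⟩
    · obtain rfl | hne := c.eq_empty_or_nonempty
      · rw [Set.sInter_empty]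
        exact Set.univ_nonempty
      · have := hne.coe_sort
        rw [Set.sInter_eq_iInter]
        exact IsCompact.nonempty_iInter_of_directed_nonempty_isCompact_isClosed _
          (DirectedOn.directed_val (IsChain.directedOn hch.symm)) (fun i => (hcs i.prop).2.1)
          (fun i => (hcs i.prop).1.isCompact) (fun i => (hcs i.prop).1)
    · rw [Set.mem_sInter] at hn ⊢
      exact fun t ht => (hcs ht).2.2 m n (hn t ht)
  obtain ⟨hNc, hNn, hNm⟩ := hN.prop
  obtain ⟨w, hwN, hw⟩ := exists_idempotent_in_compact_subsemigroup hc N hNn hNc.isCompact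
    fun x _ y hy => hNm x y hy
  refine ⟨w, hw, fun q hq hwq hqw => ?_⟩
  have hqN : q ∈ N := hqw ▸ hNm q w hwN
  have himg : (· * q) '' Set.univ = N := by
    refine hN.eq_of_subset ⟨(hc q).isClosedMap _ isClosed_univ, ⟨_, q, trivial, rfl⟩, ?_⟩ ?_
    · rintro m _ ⟨x, -, rfl⟩
      exact ⟨m * x, trivial, mul_assoc _ _ _⟩
    · rintro _ ⟨x, -, rfl⟩
      exact hNm x q hqN
  obtain ⟨z, -, hz⟩ : w ∈ (· * q) '' Set.univ := himg ▸ hwN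
  have hz' : z * q = w := hz
  have : w * q = w := by rw [← hz', mul_assoc, hq]
  rw [← hwq, this]

theorem Ultrafilter.map_mul_hom {M N : Type*} [Semigroup M] [Semigroup N] (f : M →ₙ* N)
    (U V : Ultrafilter M) : (U * V).map f = U.map f * V.map f := by
  refine Ultrafilter.coe_inj.mp <| Filter.ext' fun p => ?_
  rw [Ultrafilter.eventually_mul]
  simp only [Ultrafilter.coe_map, Filter.eventually_map, Ultrafilter.eventually_mul, map_mul]

/-- If the semigroup `S` retracts onto `W` by the homomorphisms `φ a`, every right ideal of `S`
carries an ultrafilter whose images under the `φ a` all fix a common ultrafilter on `W` and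
absorb one another. -/
theorem exists_absorbing_ultrafilter {S W Λ : Type*} [Semigroup S] [Semigroup W] [Nonempty W]
    (ι : W →ₙ* S) (φ : Λ → S →ₙ* W) (hφ : ∀ a x, φ a (ι x) = x)
    (V : Set S) (hVn : V.Nonempty) (hV : ∀ x ∈ V, ∀ y, x * y ∈ V) :
    ∃ (w : Ultrafilter W) (e : Ultrafilter S), V ∈ e ∧ (∀ a, w * e.map (φ a) = w) ∧
      ∀ a b, e.map (φ a) * e.map (φ b) = e.map (φ a) := by
  obtain ⟨w, hw, hmin⟩ := exists_minimal_idempotent (M := Ultrafilter W)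
    Ultrafilter.continuous_mul_left
  have hVK : ∀ x y : Ultrafilter S, V ∈ x → V ∈ x * y := fun x y hx => by
    have : ∀ᶠ m in ↑(x * y), m ∈ V := by
      rw [Ultrafilter.eventually_mul]
      exact Filter.mem_of_superset hx fun m hm => Eventually.of_forall fun m' => hV m hm m'
    exact this
  obtain ⟨e, ⟨y, hy, rfl⟩, he⟩ := exists_idempotent_in_compact_subsemigroup
    (Ultrafilter.continuous_mul_left (M := S)) ((· * w.map ι) '' {x | V ∈ x})
    (by
      obtain ⟨v, hv⟩ := hVn
      exact ⟨_, pure v, hv, rfl⟩)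
    ((ultrafilter_isClosed_basic V).isCompact.image (Ultrafilter.continuous_mul_left _))
    (by
      rintro _ ⟨x, hx, rfl⟩ _ ⟨z, -, rfl⟩
      exact ⟨x * (w.map ι * z), hVK _ _ hx, by simp only [mul_assoc]⟩)
  simp only at he
  set e := y * w.map ι with he_def
  have hret : ∀ a, (w.map ι).map (φ a) = w := fun a => by
    rw [Ultrafilter.map_map, show (φ a) ∘ ι = id from funext (hφ a), Ultrafilter.map_id]
  have hew : ∀ a, e.map (φ a) * w = e.map (φ a) := fun a => by
    rw [he_def, Ultrafilter.map_mul_hom, hret, mul_assoc, hw]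
  have hee : ∀ a, e.map (φ a) * e.map (φ a) = e.map (φ a) := fun a => by
    rw [← Ultrafilter.map_mul_hom, he]
  have hwe : ∀ a, w * e.map (φ a) = w := fun a => by
    refine hmin _ ?_ ?_ ?_
    · rw [mul_assoc, ← mul_assoc _ w, hew, hee]
    · rw [← mul_assoc, hw]
    · rw [mul_assoc, hew]
  refine ⟨w, e, hVK _ _ hy, hwe, fun a b => ?_⟩
  rw [← hew a, mul_assoc, hwe]

/-- Substitute the letter `a` for the variable `none` in a word. -/
def substVar {A : Type*} (a : A) (x : List (Option A)) : List A := x.map (·.getD a)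

/-- Concatenate the words `y 0, y 1, …`, substituting the successive letters of `a` for
the variable. -/
def substWord {A : Type*} : (ℕ → List (Option A)) → List A → List A
  | _, [] => []
  | y, a :: as => substVar a (y 0) ++ substWord (fun n => y (n + 1)) as

theorem substWord_concat {A : Type*} (y : ℕ → List (Option A)) (as : List A) (a : A) :
    substWord y (as ++ [a]) = substWord y as ++ substVar a (y as.length) := by
  induction as generalizing y with
  | nil => simp [substWord]
  | cons b bs ih => simp [substWord, ih]

theorem length_substWord {A : Type*} (y : ℕ → List (Option A)) (as : List A) :
    (substWord y as).length = ∑ i ∈ Finset.range as.length, (y i).length := by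
  induction as using List.reverseRecOn with
  | nil => simp [substWord]
  | append_singleton bs b ih => simp [substWord_concat, Finset.sum_range_succ, ih, substVar]

theorem map_substWord {A B : Type*} (g : A → B) (y : ℕ → List (Option A)) (as : List A) :
    (substWord y as).map g = substWord (fun n => (y n).map (Option.map g)) (as.map g) := by
  induction as using List.reverseRecOn with
  | nil => simp [substWord]
  | append_singleton bs b ih =>
    rw [substWord_concat, List.map_append, ih, List.map_append, List.map_singleton,
      substWord_concat]
    congr 1
    simp only [substVar, List.map_map, List.length_map]
    congr 1
    funext o
    cases o <;> rfl

/-- Some colour class contains a set of words closed under extension by a common left variable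
word, for any finitely many of its elements. -/
theorem exists_extendible_words {A : Type*} [Finite A] {κ : Type*} [Finite κ]
    (χ : List A → κ) :
    ∃ (ε : κ) (P : Set (List A)), P.Nonempty ∧ (∀ x ∈ P, χ x = ε) ∧
      ∀ F : Finset (List A), (∀ x ∈ F, x ∈ P) →
        ∃ y : List (Option A), y.head? = some none ∧ ∀ x ∈ F, ∀ a, x ++ substVar a y ∈ P := by
  let φ : A → FreeMonoid (Option A) →ₙ* FreeMonoid A := fun a =>
    (FreeMonoid.map (fun o : Option A => o.getD a) : FreeMonoid (Option A) →* FreeMonoid A)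
  obtain ⟨w, e, hV, hwe, hee⟩ := exists_absorbing_ultrafilter
    ((FreeMonoid.map some : FreeMonoid A →* FreeMonoid (Option A)) :
      FreeMonoid A →ₙ* FreeMonoid (Option A)) φ
    (fun a x => by
      have h : ∀ l : List A, (l.map some).map (fun o => o.getD a) = l := by simp
      exact h x)
    {x | (FreeMonoid.toList x).head? = some none} ⟨FreeMonoid.of none, rfl⟩
    (fun x hx y => by
      simp only [Set.mem_ofPred_eq, FreeMonoid.toList_mul, List.head?_append] at hx ⊢
      simp [hx])
  obtain ⟨ε, hε⟩ : ∃ ε, ∀ᶠ x in w, χ (FreeMonoid.toList x) = ε := by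
    have h : ∀ᶠ x in (w : Filter _), ∃ ε, χ (FreeMonoid.toList x) = ε :=
      Eventually.of_forall fun x => ⟨_, rfl⟩
    exact Ultrafilter.eventually_exists_iff.mp h
  let P : Set (FreeMonoid A) := {x | χ (FreeMonoid.toList x) = ε ∧
    ∀ a, ∀ᶠ y in e, χ (FreeMonoid.toList (x * φ a y)) = ε}
  have hstep : ∀ a, ∀ᶠ x in w, ∀ᶠ y in e, χ (FreeMonoid.toList (x * φ a y)) = ε := fun a => by
    have h := hε
    rw [← hwe a, Ultrafilter.eventually_mul] at h
    exact h
  have hP : ∀ᶠ x in w, x ∈ P := hε.and (eventually_all.mpr hstep)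
  refine ⟨ε, P, hP.exists, fun x hx => hx.1, fun F hF => ?_⟩
  have hext : ∀ x ∈ P, ∀ a, ∀ᶠ y in e, x * φ a y ∈ P := by
    rintro x ⟨-, hx⟩ a
    refine (hx a).and (eventually_all.mpr fun b => ?_)
    have h : ∀ᶠ z in (e.map (φ a) : Filter _), χ (FreeMonoid.toList (x * z)) = ε := hx a
    rw [← hee a b, Ultrafilter.eventually_mul] at h
    simp only [← mul_assoc] at h
    exact h
  have hall : ∀ᶠ y in e, ∀ x ∈ F, ∀ a, FreeMonoid.ofList x * φ a y ∈ P := by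
    rw [Filter.eventually_all_finset]
    exact fun x hx => eventually_all.mpr (hext x (hF x hx))
  obtain ⟨y, hy, hy'⟩ := (hall.and hV).exists
  exact ⟨y, hy', hy⟩

/-- The Carlson–Simpson theorem for left variable words over a finite alphabet. -/
theorem exists_left_variable_words {A : Type*} [Finite A] {κ : Type*} [Finite κ]
    (χ : List A → κ) :
    ∃ (ε : κ) (x : List A) (y : ℕ → List (Option A)), (∀ n, (y n).head? = some none) ∧
      ∀ as, χ (x ++ substWord y as) = ε := by
  classical
  obtain ⟨ε, P, ⟨x, hx⟩, hPε, hP⟩ := exists_extendible_words χ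
  have := Fintype.ofFinite A
  choose! Y hY hYP using hP
  let next : Finset (List A) → Finset (List A) := fun F =>
    F.biUnion fun z => Finset.univ.image fun a => z ++ substVar a (Y F)
  let F : ℕ → Finset (List A) := fun n => next^[n] {x}
  have hFs : ∀ n, F (n + 1) = next (F n) := fun n => Function.iterate_succ_apply' _ _ _
  have hF : ∀ n, ∀ z ∈ F n, z ∈ P := by
    intro n
    induction n with
    | zero => simpa [F] using hx
    | succ n ih =>
      intro z hz
      rw [hFs] at hz
      simp only [next, Finset.mem_biUnion, Finset.mem_image, Finset.mem_univ, true_and] at hz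
      obtain ⟨z', hz', a, rfl⟩ := hz
      exact hYP _ ih _ hz' a
  refine ⟨ε, x, fun n => Y (F n), fun n => hY _ (hF n), fun as => hPε _ (hF as.length _ ?_)⟩
  induction as using List.reverseRecOn with
  | nil => simp [substWord, F]
  | append_singleton bs b ih =>
    rw [substWord_concat, ← List.append_assoc, List.length_append, List.length_singleton, hFs]
    simp only [next, Finset.mem_biUnion, Finset.mem_image, Finset.mem_univ, true_and]
    exact ⟨_, ih, b, rfl⟩

end UltrafilterRamsey

/-- `f` is a strong embedding of `2^{<ω}` into itself with level function `h`: it maps level `n`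
to level `h n`, and the image of `s ++ [b]` extends `f s ++ [b]`. -/
structure IsStrongEmb (f : List Bool → List Bool) (h : ℕ → ℕ) : Prop where
  length_apply : ∀ s, (f s).length = h s.length
  append_isPrefix : ∀ s b, f s ++ [b] <+: f (s ++ [b])

theorem List.IsPrefix.eq_or_exists_append_singleton {α : Type*} {s t : List α} (h : s <+: t) :
    s = t ∨ ∃ b, s ++ [b] <+: t := by
  obtain ⟨r, rfl⟩ := h
  cases r with
  | nil => exact Or.inl (by simp)
  | cons b r => exact Or.inr ⟨b, r, by simp⟩

theorem List.IsPrefix.eq_of_append_singleton {α : Type*} {s t : List α} {a b : α}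
    (ha : s ++ [a] <+: t) (hb : s ++ [b] <+: t) : a = b := by
  have h := (List.prefix_of_prefix_length_le ha hb (by simp)).eq_of_length (by simp)
  simpa using h

/-- Two distinct sequences of the same length branch at some node. -/
theorem exists_branching {x y : List Bool} (hl : x.length = y.length) (hne : x ≠ y) :
    ∃ u b, u ++ [b] <+: x ∧ u ++ [!b] <+: y := by
  induction x generalizing y with
  | nil =>
    cases y with
    | nil => exact absurd rfl hne
    | cons => simp at hl
  | cons a x ih =>
    cases y with
    | nil => simp at hl
    | cons c y =>
      by_cases hac : a = c
      · subst hac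
        obtain ⟨u, b, h1, h2⟩ := ih (by simpa using hl) (by simpa using hne)
        exact ⟨a :: u, b, by simpa using h1, by simpa using h2⟩
      · refine ⟨[], a, by simp, ?_⟩
        have : c = !a := by cases a <;> cases c <;> simp_all
        simp [this]

namespace IsStrongEmb

variable {f g : List Bool → List Bool} {h h' : ℕ → ℕ}

theorem strictMono (hf : IsStrongEmb f h) : StrictMono h := by
  refine strictMono_nat_of_lt_succ fun n => ?_
  have := (hf.append_isPrefix (List.replicate n false) false).length_le
  simpa [hf.length_apply] using this

theorem apply_isPrefix (hf : IsStrongEmb f h) {s t : List Bool} (hst : s <+: t) : f s <+: f t := by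
  obtain ⟨r, rfl⟩ := hst
  induction r using List.reverseRecOn with
  | nil => simp
  | append_singleton r b ih =>
    rw [← List.append_assoc]
    exact ih.trans ((List.prefix_append _ _).trans (hf.append_isPrefix _ b))

theorem append_isPrefix_apply (hf : IsStrongEmb f h) {s t : List Bool} {b : Bool}
    (hst : s ++ [b] <+: t) : f s ++ [b] <+: f t :=
  (hf.append_isPrefix s b).trans (hf.apply_isPrefix hst)

theorem injective (hf : IsStrongEmb f h) : Function.Injective f := by
  intro s t hst
  have hl : s.length = t.length := hf.strictMono.injective (by
    rw [← hf.length_apply, ← hf.length_apply, hst])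
  by_contra hne
  obtain ⟨u, b, h1, h2⟩ := exists_branching hl hne
  have h1' := hf.append_isPrefix_apply h1
  rw [hst] at h1'
  have := h1'.eq_of_append_singleton (hf.append_isPrefix_apply h2)
  cases b <;> simp at this

theorem prefix_iff (hf : IsStrongEmb f h) {s t : List Bool} : f s <+: f t ↔ s <+: t := by
  refine ⟨fun hst => ?_, hf.apply_isPrefix⟩
  have hl : s.length ≤ t.length := by
    rw [← hf.strictMono.le_iff_le, ← hf.length_apply, ← hf.length_apply]
    exact hst.length_le
  have htk := hf.apply_isPrefix (List.take_prefix s.length t)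
  have hle : (f s).length = (f (t.take s.length)).length := by
    simp [hf.length_apply, hl]
  have heq := (List.prefix_of_prefix_length_le hst htk hle.le).eq_of_length hle
  rw [hf.injective heq]
  exact List.take_prefix _ _

theorem append_isPrefix_iff (hf : IsStrongEmb f h) {s t : List Bool} {b : Bool} :
    f s ++ [b] <+: f t ↔ s ++ [b] <+: t := by
  refine ⟨fun hst => ?_, hf.append_isPrefix_apply⟩
  obtain rfl | ⟨c, hc⟩ :=
    (hf.prefix_iff.mp ((List.prefix_append _ _).trans hst)).eq_or_exists_append_singleton
  · simpa using hst.length_le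
  · rwa [hst.eq_of_append_singleton (hf.append_isPrefix_apply hc)]

theorem comp (hf : IsStrongEmb f h) (hg : IsStrongEmb g h') : IsStrongEmb (f ∘ g) (h ∘ h') where
  length_apply s := by simp [hf.length_apply, hg.length_apply]
  append_isPrefix s b := hf.append_isPrefix_apply (hg.append_isPrefix s b)

/-- A strong embedding factors through any strong embedding whose range contains its range. -/
theorem exists_factor (hf : IsStrongEmb f h) (hg : IsStrongEmb g h')
    (hr : Set.range g ⊆ Set.range f) : ∃ p k, IsStrongEmb p k ∧ g = f ∘ p := by
  choose p hp using fun s => hr ⟨s, rfl⟩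
  have hlen : ∀ s t, s.length = t.length → (p s).length = (p t).length := fun s t hst =>
    hf.strictMono.injective (by
      rw [← hf.length_apply, ← hf.length_apply, hp, hp, hg.length_apply, hg.length_apply, hst])
  refine ⟨p, fun n => (p (List.replicate n false)).length, ⟨fun s => hlen _ _ (by simp),
    fun s b => ?_⟩, funext fun s => (hp s).symm⟩
  rw [← hf.append_isPrefix_iff, hp, hp]
  exact hg.append_isPrefix s b

theorem isInfStrongTree_range (hf : IsStrongEmb f h) : IsInfStrongTree (Set.range f) := by
  refine ⟨Set.range h, Set.infinite_range_of_injective hf.strictMono.injective,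
    Set.range_nonempty f, ?_, ?_, ?_, ?_, ?_⟩
  · rintro _ ⟨s, rfl⟩
    exact ⟨_, (hf.length_apply s).symm⟩
  · rintro u ⟨_, ⟨t, rfl⟩, hu⟩ ⟨n, hn⟩
    have hnt : n ≤ t.length := by
      rw [← hf.strictMono.le_iff_le, hn, ← hf.length_apply]
      exact hu.length_le
    have hle : (f (t.take n)).length = u.length := by simp [hf.length_apply, hnt, hn]
    exact ⟨t.take n, (List.prefix_of_prefix_length_le
      (hf.apply_isPrefix (List.take_prefix n t)) hu hle.le).eq_of_length hle⟩
  · rintro _ ⟨s, rfl⟩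
    exact ⟨⟨_, ⟨s ++ [false], rfl⟩, hf.append_isPrefix _ _⟩,
      ⟨_, ⟨s ++ [true], rfl⟩, hf.append_isPrefix _ _⟩⟩
  · rintro u - ⟨⟨_, ⟨t, rfl⟩, ht⟩, ⟨_, ⟨t', rfl⟩, ht'⟩⟩
    have hex : ∃ n, u.length ≤ h n := ⟨u.length, hf.strictMono.le_apply⟩
    classical
    obtain ⟨n, hn, hmin⟩ : ∃ n, u.length ≤ h n ∧ ∀ m < n, h m < u.length :=
      ⟨Nat.find hex, Nat.find_spec hex, fun m hm => not_le.mp (Nat.find_min hex hm)⟩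
    by_contra hu
    have hlt : u.length < h n := lt_of_le_of_ne hn fun he => hu ⟨n, he.symm⟩
    have key : ∀ (t : List Bool) (b : Bool), u ++ [b] <+: f t →
        ∃ s, s.length = n ∧ u ++ [b] <+: f s := fun t b ht => by
      have hnt : n ≤ t.length := by
        by_contra hcon
        have h1 := hmin _ (not_le.mp hcon)
        have h2 := ht.length_le
        rw [hf.length_apply, List.length_append] at h2
        omega
      refine ⟨t.take n, by simp [hnt], List.prefix_of_prefix_length_le ht
        (hf.apply_isPrefix (List.take_prefix n t)) ?_⟩
      simpa [hf.length_apply, hnt] using hlt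
    obtain ⟨s, hs, hsu⟩ := key t _ ht
    obtain ⟨s', hs', hsu'⟩ := key t' _ ht'
    have hss : s ≠ s' := by
      rintro rfl
      simpa using hsu.eq_of_append_singleton hsu'
    obtain ⟨v, b, hv, hv'⟩ := exists_branching (hs.trans hs'.symm) hss
    have hvn : v.length < n := by
      have := hv.length_le
      simp only [List.length_append, List.length_singleton] at this
      omega
    have hvu : ∀ s c d, v ++ [c] <+: s → u ++ [d] <+: f s → f v ++ [c] <+: u := fun s c d h1 h2 =>
      List.prefix_of_prefix_length_le (hf.append_isPrefix_apply h1)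
        ((List.prefix_append _ _).trans h2) (by simpa [hf.length_apply] using hmin _ hvn)
    have := (hvu _ _ _ hv hsu).eq_of_append_singleton (hvu _ _ _ hv' hsu')
    cases b <;> simp at this
  · rintro _ ⟨n, rfl⟩
    exact ⟨_, ⟨List.replicate n false, rfl⟩, by simp [hf.length_apply]⟩

theorem rk_range (hf : IsStrongEmb f h) (k : ℕ) :
    rk k (Set.range f) = f '' {s | s.length < k} := by
  have hcard : ∀ t, {s | s ∈ Set.range f ∧ s <+: f t ∧ s ≠ f t}.ncard = t.length := fun t => by
    have hset : {s | s ∈ Set.range f ∧ s <+: f t ∧ s ≠ f t} =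
        (fun i => f (t.take i)) '' (Finset.range t.length : Set ℕ) := by
      ext u
      constructor
      · rintro ⟨⟨s, rfl⟩, h1, h2⟩
        have hst := hf.prefix_iff.mp h1
        refine ⟨s.length, ?_, ?_⟩
        · simp only [Finset.coe_range, Set.mem_Iio]
          exact lt_of_le_of_ne hst.length_le fun he => h2 (by rw [hst.eq_of_length he])
        · simp only
          rw [← List.prefix_iff_eq_take.mp hst]
      · rintro ⟨i, hi, rfl⟩
        simp only [Finset.coe_range, Set.mem_Iio] at hi
        refine ⟨⟨_, rfl⟩, hf.apply_isPrefix (List.take_prefix _ _), fun he => ?_⟩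
        have := congrArg List.length (hf.injective he)
        simp only [List.length_take] at this
        omega
    rw [hset, Set.InjOn.ncard_image, Set.ncard_coe_finset, Finset.card_range]
    intro i hi j hj hij
    simp only [Finset.coe_range, Set.mem_Iio] at hi hj
    have := congrArg List.length (hf.injective hij)
    simp only [List.length_take] at this
    omega
  ext u
  constructor
  · rintro ⟨⟨t, rfl⟩, ht⟩
    exact ⟨t, (hcard t).symm.trans_lt ht, rfl⟩
  · rintro ⟨t, ht, rfl⟩
    exact ⟨⟨t, rfl⟩, (hcard t).trans_lt ht⟩

end IsStrongEmb

/-- Every infinite strong subtree is the range of a strong embedding. -/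
theorem IsInfStrongTree.exists_isStrongEmb {T : Set (List Bool)} (hT : IsInfStrongTree T) :
    ∃ f h, IsStrongEmb f h ∧ Set.range f = T := by
  obtain ⟨L, hL, -, hlen, hdown, hsplit, hlev, hreal⟩ := hT
  let h : ℕ → ℕ := Nat.nth (· ∈ L)
  have hmono : StrictMono h := Nat.nth_strictMono hL
  have hrange : Set.range h = L := Nat.range_nth_of_infinite hL
  have hbranch : ∀ x ∈ T, ∀ y ∈ T, ∀ u b, u ++ [b] <+: x → u ++ [!b] <+: y → u.length ∈ L := by
    intro x hx y hy u b h1 h2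
    refine hlev u ⟨x, hx, (List.prefix_append _ _).trans h1⟩ ?_
    cases b
    · exact ⟨⟨x, hx, h1⟩, ⟨y, hy, h2⟩⟩
    · exact ⟨⟨y, hy, h2⟩, ⟨x, hx, h1⟩⟩
  have hnext : ∀ s b, ∃ y, s ∈ T → y ∈ T ∧ s ++ [b] <+: y ∧
      ∀ n, s.length = h n → y.length = h (n + 1) := by
    intro s b
    by_cases hs : s ∈ T
    · obtain ⟨n, hn⟩ : s.length ∈ Set.range h := hrange ▸ hlen s hs
      obtain ⟨t, ht, hst⟩ : s ++ [b] ∈ downcl T := by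
        cases b
        exacts [(hsplit s hs).1, (hsplit s hs).2]
      obtain ⟨m, hm⟩ : t.length ∈ Set.range h := hrange ▸ hlen t ht
      have hst' := hst.length_le
      simp only [List.length_append, List.length_singleton] at hst'
      have hnm : n < m := by rw [← hmono.lt_iff_lt]; omega
      have hle : h (n + 1) ≤ t.length := hm ▸ hmono.monotone hnm
      have hlt : h n < h (n + 1) := hmono (Nat.lt_succ_self n)
      have htl : (t.take (h (n + 1))).length = h (n + 1) := by simp [hle]
      refine ⟨t.take (h (n + 1)), fun _ => ⟨?_, ?_, ?_⟩⟩
      · refine hdown _ ⟨t, ht, List.take_prefix _ _⟩ ?_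
        rw [htl, ← hrange]
        exact ⟨_, rfl⟩
      · refine List.prefix_of_prefix_length_le hst (List.take_prefix _ _) ?_
        rw [htl, List.length_append, List.length_singleton]
        omega
      · intro n' hn'
        rw [htl, hmono.injective (hn.trans hn')]
    · exact ⟨[], fun hs' => absurd hs' hs⟩
  choose nxt hnxt using hnext
  obtain ⟨root, hroot, hrootl⟩ := hreal (h 0) (hrange ▸ ⟨0, rfl⟩)
  let f : List Bool → List Bool := fun s => s.foldl nxt root
  have hfs : ∀ s b, f (s ++ [b]) = nxt (f s) b := fun s b => by simp [f]
  have hf : ∀ s, f s ∈ T ∧ (f s).length = h s.length := by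
    intro s
    induction s using List.reverseRecOn with
    | nil => exact ⟨hroot, hrootl⟩
    | append_singleton s b ih =>
      rw [hfs, List.length_append, List.length_singleton]
      exact ⟨(hnxt _ b ih.1).1, (hnxt _ b ih.1).2.2 _ ih.2⟩
  have hemb : IsStrongEmb f h :=
    ⟨fun s => (hf s).2, fun s b => by rw [hfs]; exact (hnxt _ b (hf s).1).2.1⟩
  refine ⟨f, h, hemb, Set.Subset.antisymm (by rintro _ ⟨s, rfl⟩; exact (hf s).1) fun t ht => ?_⟩
  have hall : ∀ n, ∀ t ∈ T, t.length = h n → t ∈ Set.range f := by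
    intro n
    induction n with
    | zero =>
      intro t ht htl
      refine ⟨[], ?_⟩
      by_contra hne
      obtain ⟨u, b, h1, h2⟩ := exists_branching (hrootl.trans htl.symm) hne
      obtain ⟨m, hm⟩ : u.length ∈ Set.range h := hrange ▸ hbranch _ hroot _ ht u b h1 h2
      have := h1.length_le
      have := hmono.monotone (Nat.zero_le m)
      simp only [List.length_append, List.length_singleton] at *
      omega
    | succ n ih =>
      intro t ht htl
      have hlt : h n < h (n + 1) := hmono (Nat.lt_succ_self n)
      have htk : (t.take (h n)).length = h n := by simp; omega
      obtain ⟨s, hs⟩ := ih (t.take (h n))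
        (hdown _ ⟨t, ht, List.take_prefix _ _⟩ (by rw [htk, ← hrange]; exact ⟨n, rfl⟩)) htk
      have hsl : s.length = n := hmono.injective (by rw [← (hf s).2, hs, htk])
      obtain he | ⟨b, hb⟩ := (hs ▸ List.take_prefix (h n) t :
        f s <+: t).eq_or_exists_append_singleton
      · have := (hf s).2
        rw [he, hsl] at this
        omega
      refine ⟨s ++ [b], ?_⟩
      have hfl : (f (s ++ [b])).length = h (n + 1) := by rw [(hf _).2]; simp [hsl]
      by_contra hne
      obtain ⟨u, c, h1, h2⟩ := exists_branching (hfl.trans htl.symm) hne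
      obtain ⟨m, hm⟩ : u.length ∈ Set.range h :=
        hrange ▸ hbranch _ (hf _).1 _ ht u c h1 h2
      have hul : u.length < h (n + 1) := by
        have := h1.length_le
        simp only [List.length_append, List.length_singleton] at this
        omega
      have hmn : m ≤ n := by
        rw [← hm, hmono.lt_iff_lt] at hul
        omega
      have hul' : u.length < (f s ++ [b]).length := by
        have := hmono.monotone hmn
        rw [List.length_append, (hf s).2, hsl, List.length_singleton]
        omega
      have hpre : ∀ {x c}, f s ++ [b] <+: x → u ++ [c] <+: x → u ++ [c] <+: f s ++ [b] :=
        fun hx hu => List.prefix_of_prefix_length_le hu hx (by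
          rw [List.length_append]; exact hul')
      have := (hpre (hemb.append_isPrefix s b) h1).eq_of_append_singleton (hpre hb h2)
      cases c <;> simp at this
  obtain ⟨n, hn⟩ : t.length ∈ Set.range h := hrange ▸ hlen t ht
  exact hall n t ht hn.symm

/-- Keep the nodes below level `k`, and above a node `d` of level `k` insert the `d`-th coordinates
of the word `x` and of the variable words `y 0, y 1, …`. -/
def graft (k : ℕ) (x : List (List.Vector Bool k → Bool))
    (y : ℕ → List (Option (List.Vector Bool k → Bool))) (t : List Bool) : List Bool :=
  if ht : k ≤ t.length then
    let d : List.Vector Bool k := ⟨t.take k, by simp [ht]⟩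
    t.take k ++ (x.map (· d) ++ substWord (fun n => (y n).map (Option.map (· d))) (t.drop k))
  else t

section Graft

variable {k : ℕ} {x : List (List.Vector Bool k → Bool)}
  {y : ℕ → List (Option (List.Vector Bool k → Bool))}

theorem graft_of_lt {t : List Bool} (ht : t.length < k) : graft k x y t = t :=
  dif_neg (not_le.mpr ht)

theorem graft_append (d : List.Vector Bool k) (b : List Bool) :
    graft k x y (d.1 ++ b) =
      d.1 ++ (x.map (· d) ++ substWord (fun n => (y n).map (Option.map (· d))) b) := by
  have hk : k ≤ (d.1 ++ b).length := by simp [d.2]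
  have htake : (d.1 ++ b).take k = d.1 := List.take_left' d.2
  have hdrop : (d.1 ++ b).drop k = b := List.drop_left' d.2
  have hd : (⟨(d.1 ++ b).take k, by simp [d.2]⟩ : List.Vector Bool k) = d := Subtype.ext htake
  rw [graft, dif_pos hk]
  simp only [hd, hdrop]
  rw [htake]

theorem exists_vector_append {t : List Bool} (ht : k ≤ t.length) :
    ∃ (d : List.Vector Bool k) (b : List Bool), t = d.1 ++ b :=
  ⟨⟨t.take k, by simp [ht]⟩, t.drop k, (List.take_append_drop k t).symm⟩

theorem isStrongEmb_graft (hy : ∀ n, (y n).head? = some none) :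
    IsStrongEmb (graft k x y)
      (fun n => if k ≤ n then k + (x.length + ∑ i ∈ Finset.range (n - k), (y i).length) else n) := by
  constructor
  · intro t
    by_cases ht : k ≤ t.length
    · obtain ⟨d, b, rfl⟩ := exists_vector_append ht
      have hd : d.1.length = k := d.2
      rw [graft_append, if_pos ht]
      simp [length_substWord, hd]
    · rw [graft_of_lt (not_le.mp ht), if_neg ht]
  · intro t b
    by_cases ht : k ≤ t.length
    · obtain ⟨d, s, rfl⟩ := exists_vector_append ht
      rw [List.append_assoc, graft_append, graft_append, substWord_concat]
      simp only [List.append_assoc, List.prefix_append_right_inj]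
      obtain ⟨r, hr⟩ : ∃ r, y s.length = none :: r := by
        have := hy s.length
        cases h0 : y s.length with
        | nil => simp [h0] at this
        | cons o r => exact ⟨r, by simp_all⟩
      simp [hr, substVar]
    · rw [graft_of_lt (not_le.mp ht)]
      rcases Nat.lt_or_ge (t.length + 1) k with h | h
      · rw [graft_of_lt (by simpa using h)]
      · obtain ⟨d, s, hds⟩ := exists_vector_append (k := k) (t := t ++ [b]) (by simpa using h)
        rw [hds, graft_append]
        have hs : s = [] := by
          have hl := congrArg List.length hds
          have hd : d.1.length = k := d.2
          simp only [List.length_append, List.length_singleton, hd] at hl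
          exact List.eq_nil_of_length_eq_zero (by omega)
        subst hs
        simp

end Graft

/-- A strong embedding preserving the set of nodes below level `k` extends every node up to
level `k`. -/
theorem IsStrongEmb.isPrefix_apply_of_image_eq {p : List Bool → List Bool} {h : ℕ → ℕ}
    (hp : IsStrongEmb p h) {k : ℕ} (himg : p '' {s | s.length < k} ⊆ {s | s.length < k})
    {s : List Bool} (hs : s.length ≤ k) : s <+: p s := by
  have hh : ∀ j, j < k → h j = j := fun j hj => by
    refine le_antisymm ?_ hp.strictMono.le_apply
    have hlast : h (k - 1) < k := by
      have := himg ⟨List.replicate (k - 1) false, by simp; omega, rfl⟩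
      simpa [hp.length_apply] using this
    have := hp.strictMono.add_le_nat (k - 1 - j) j
    have he : k - 1 - j + j = k - 1 := by omega
    rw [he] at this
    omega
  induction s using List.reverseRecOn with
  | nil => simp
  | append_singleton s b ih =>
    simp only [List.length_append, List.length_singleton] at hs
    have heq := (ih (by omega)).eq_of_length (by rw [hp.length_apply, hh _ (by omega)])
    have := hp.append_isPrefix s b
    rwa [← heq] at this

/-- **Pigeonhole principle for the Milliken space.** Let `U` be a finite strong subtree of
`2^{<ω}` with `k` levels and `T` an infinite strong subtree of `2^{<ω}` such that
`r_{k+1}[U,T]` is nonempty.  Then for every finite coloring of `r_{k+1}[U,T]` there is an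
infinite strong subtree `S ⊆ T` with `r_k(S) = U` such that all members of `r_{k+1}[U,S]`
get the same color. -/
theorem milliken_pigeonhole (k : ℕ) (U : Set (List Bool))
    (hU : ∃ L : Finset ℕ, L.card = k ∧ IsFinStrongTree U L)
    (T : Set (List Bool)) (hT : IsInfStrongTree T)
    (hne : ∃ S : Set (List Bool), S ⊆ T ∧ IsInfStrongTree S ∧ rk k S = U)
    (σ : ℕ) (c : Set (List Bool) → Fin (σ + 1)) :
    ∃ S : Set (List Bool), S ⊆ T ∧ IsInfStrongTree S ∧ rk k S = U ∧
      ∃ ε : Fin (σ + 1), ∀ V : Set (List Bool),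
        (∃ S' : Set (List Bool), S' ⊆ S ∧ IsInfStrongTree S' ∧ rk k S' = U ∧ rk (k + 1) S' = V) →
        c V = ε := by
  obtain ⟨T₀, hT₀T, hT₀, rfl⟩ := hne
  obtain ⟨f, h, hf, rfl⟩ := hT₀.exists_isStrongEmb
  rw [hf.rk_range]
  obtain ⟨ε, x, y, hy, hχ⟩ := exists_left_variable_words
    (fun z : List (List.Vector Bool k → Bool) => c (f '' {s | s.length < k} ∪
      f '' Set.range fun d : List.Vector Bool k => d.1 ++ z.map (· d)))
  have hg := isStrongEmb_graft (x := x) hy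
  have hgk : graft k x y '' {s | s.length < k} = {s | s.length < k} :=
    (Set.image_congr fun s hs => graft_of_lt hs).trans (Set.image_id' _)
  have hfg := hf.comp hg
  have hsub : Set.range (f ∘ graft k x y) ⊆ Set.range f := Set.range_comp_subset_range _ _
  refine ⟨Set.range (f ∘ graft k x y), hsub.trans hT₀T, hfg.isInfStrongTree_range,
    by rw [hfg.rk_range, Set.image_comp, hgk], ε, ?_⟩
  rintro _ ⟨S, hS, hSinf, hSk, rfl⟩
  obtain ⟨q, h', hq, rfl⟩ := hSinf.exists_isStrongEmb
  obtain ⟨p, h'', hp, rfl⟩ := hfg.exists_factor hq hS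
  rw [hq.rk_range] at hSk
  have hpk : p '' {s | s.length < k} = {s | s.length < k} := by
    apply hfg.injective.image_injective
    rw [← Set.image_comp, hSk, Set.image_comp f, hgk]
  have hpre : ∀ d : List.Vector Bool k, ∃ b, p d.1 = d.1 ++ b := fun d => by
    obtain ⟨b, hb⟩ := hp.isPrefix_apply_of_image_eq hpk.subset (s := d.1) d.2.le
    exact ⟨b, hb.symm⟩
  choose b hb using hpre
  have hbl : ∀ d, (b d).length = h'' k - k := fun d => by
    have h1 := hp.length_apply d.1
    have hd : d.1.length = k := d.2
    rw [hb, List.length_append, hd] at h1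
    omega
  let as : List (List.Vector Bool k → Bool) :=
    List.ofFn fun (i : Fin (h'' k - k)) d => (b d).getD i false
  have has : ∀ d, as.map (· d) = b d := fun d => by
    apply List.ext_getElem
    · simp [as, hbl]
    · intro i h1 h2
      simp [as, List.getElem?_eq_getElem h2]
  rw [← hχ as]
  congr 1
  have hlevels : {s : List Bool | s.length < k + 1} =
      {s | s.length < k} ∪ Set.range fun d : List.Vector Bool k => d.1 := by
    ext s
    simp only [Set.mem_ofPred_eq, Set.mem_union, Set.mem_range, Nat.lt_succ_iff_lt_or_eq]
    exact or_congr_right ⟨fun hs => ⟨⟨s, hs⟩, rfl⟩, by rintro ⟨d, rfl⟩; exact d.2⟩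
  rw [hq.rk_range, hlevels, Set.image_union, hSk]
  congr 1
  rw [← Set.range_comp, ← Set.range_comp]
  congr 1
  funext d
  simp only [Function.comp_apply]
  rw [hb, graft_append, List.map_append, map_substWord, has]
end

section
/- (Milliken) The Milliken space (𝓜, ≤, r) of infinite strong subtrees of 2^{<ω} is a topological Ramsey space: every subset of 𝓜 with the property of Baire (with respect to the topology generated by the basic open sets [U,T]) is Ramsey, and every meager subset of 𝓜 is Ramsey null. -/
/-- The Milliken space `𝓜` of all infinite strong subtrees of `2^{<ω}`. -/
def MSpace : Type := {T : Set (List Bool) // IsInfStrongTree T}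

/-- The basic set `[U, T] = {S ∈ 𝓜 : ∃ k, r_k(S) = U and S ⊆ T}`. -/
def mbasic (U : Set (List Bool)) (T : MSpace) : Set MSpace :=
  {S : MSpace | (∃ k : ℕ, rk k S.1 = U) ∧ S.1 ⊆ T.1}

/-- The topology on `𝓜` generated by the basic sets `[U, T]`, where `U` ranges over finite
strong trees and `T` over `𝓜`. -/
instance : TopologicalSpace MSpace :=
  TopologicalSpace.generateFrom
    {B | ∃ (U : Set (List Bool)) (T : MSpace) (L : Finset ℕ),
      IsFinStrongTree U L ∧ B = mbasic U T}

/-- `𝓧 ⊆ 𝓜` is Ramsey: for every nonempty `[U,T]` there is `S ∈ [U,T]` with `[U,S] ⊆ 𝓧`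
or `[U,S] ∩ 𝓧 = ∅`. -/
def IsRamseySet (X : Set MSpace) : Prop :=
  ∀ (U : Set (List Bool)) (T : MSpace), (mbasic U T).Nonempty →
    ∃ S ∈ mbasic U T, mbasic U S ⊆ X ∨ mbasic U S ∩ X = ∅

/-- `𝓧 ⊆ 𝓜` is Ramsey null: for every nonempty `[U,T]` there is `S ∈ [U,T]` with
`[U,S] ∩ 𝓧 = ∅`. -/
def IsRamseyNull (X : Set MSpace) : Prop :=
  ∀ (U : Set (List Bool)) (T : MSpace), (mbasic U T).Nonempty →
    ∃ S ∈ mbasic U T, mbasic U S ∩ X = ∅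

/-- A compact semigroup with continuous right translations has a nonempty closed left ideal in
which every idempotent is a left-zero with respect to the idempotents of the ideal. -/
theorem exists_isClosed_leftIdeal_idempotent_mul {M : Type*} [Nonempty M] [Semigroup M]
    [TopologicalSpace M] [CompactSpace M] [T2Space M] (hc : ∀ r : M, Continuous (· * r)) :
    ∃ N : Set M, IsClosed N ∧ N.Nonempty ∧ (∀ m, ∀ n ∈ N, m * n ∈ N) ∧
      ∀ e ∈ N, ∀ f ∈ N, f * f = f → e * f = e := by
  let S : Set (Set M) := {N | IsClosed N ∧ N.Nonempty ∧ ∀ m, ∀ n ∈ N, m * n ∈ N}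
  obtain ⟨N, hN⟩ : ∃ N, Minimal (· ∈ S) N := by
    refine zorn_superset _ fun c hcs hch => ?_
    refine ⟨⋂₀ c, ⟨isClosed_sInter fun t ht => (hcs ht).1, ?_, fun m n hn => ?_⟩,
      fun s hs => Set.sInter_subset_of_mem hs⟩
    · obtain rfl | hcn := c.eq_empty_or_nonempty
      · rw [Set.sInter_empty]
        exact Set.univ_nonempty
      · have : Nonempty c := hcn.coe_sort
        rw [Set.sInter_eq_iInter]
        exact IsCompact.nonempty_iInter_of_directed_nonempty_isCompact_isClosed _
          (DirectedOn.directed_val (IsChain.directedOn hch.symm))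
          (fun i => (hcs i.prop).2.1) (fun i => (hcs i.prop).1.isCompact)
          (fun i => (hcs i.prop).1)
    · rw [Set.mem_sInter] at hn ⊢
      exact fun t ht => (hcs ht).2.2 m n (hn t ht)
  obtain ⟨hcl, hne, hmul⟩ := hN.prop
  refine ⟨N, hcl, hne, hmul, fun e he f hf hff => ?_⟩
  have hr : Set.range (· * f) = N := by
    refine hN.eq_of_subset ⟨isCompact_range (hc f) |>.isClosed, ⟨_, e, rfl⟩, ?_⟩ ?_
    · rintro m _ ⟨n, rfl⟩
      exact ⟨m * n, mul_assoc _ _ _⟩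
    · rintro _ ⟨n, rfl⟩
      exact hmul n f hf
  obtain ⟨s, rfl⟩ := hr.symm ▸ he
  simp only [mul_assoc, hff]

section CarlsonSimpson

open Filter

attribute [local instance] Ultrafilter.mul Ultrafilter.semigroup

theorem Ultrafilter.map_mul_monoidHom {M N : Type*} [Monoid M] [Monoid N] (φ : M →* N)
    (U V : Ultrafilter M) : (U * V).map φ = U.map φ * V.map φ := by
  refine Ultrafilter.coe_inj.mp (Filter.ext' fun p => ?_)
  rw [Ultrafilter.eventually_mul]
  simp only [Ultrafilter.coe_map, Filter.eventually_map, Ultrafilter.eventually_mul, map_mul]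

theorem Ultrafilter.continuous_map {α β : Type*} (f : α → β) :
    Continuous (Ultrafilter.map f) :=
  ultrafilterBasis_is_basis.continuous_iff.2 <| Set.forall_mem_range.mpr fun s ↦
    ultrafilter_isOpen_basic (f ⁻¹' s)

variable {A : Type*}

/-- Substitution of a letter for the variable `none` in a variable word. -/
def substLetter (a : A) : FreeMonoid (Option A) →* FreeMonoid A :=
  FreeMonoid.map fun o => o.getD a

/-- Words that start with the variable. -/
def leftVariableWords (A : Type*) : Set (FreeMonoid (Option A)) :=
  Set.range fun w => FreeMonoid.of none * w

theorem mul_mem_leftVariableWords {x y : FreeMonoid (Option A)} (hx : x ∈ leftVariableWords A) :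
    x * y ∈ leftVariableWords A := by
  obtain ⟨w, rfl⟩ := hx
  exact ⟨w * y, (mul_assoc _ _ _).symm⟩

theorem exists_ultrafilter_leftVariableWords (A : Type*) [Nonempty A] :
    ∃ v : Ultrafilter (FreeMonoid (Option A)), leftVariableWords A ∈ v ∧
      ∀ a b : A, v.map (substLetter a) * v.map (substLetter b) = v.map (substLetter a) := by
  obtain ⟨N, hcl, ⟨w, hw⟩, hmul, hid⟩ :=
    exists_isClosed_leftIdeal_idempotent_mul (M := Ultrafilter (FreeMonoid A))
      Ultrafilter.continuous_mul_left
  let K : Set (Ultrafilter (FreeMonoid (Option A))) :=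
    {v | leftVariableWords A ∈ v} ∩ ⋂ a : A, Ultrafilter.map (substLetter a) ⁻¹' N
  have hKc : IsClosed K := (ultrafilter_isClosed_basic _).inter
    (isClosed_iInter fun a => hcl.preimage (Ultrafilter.continuous_map _))
  let ι : FreeMonoid A →* FreeMonoid (Option A) := FreeMonoid.map some
  have hι : ∀ a, (substLetter a).comp ι = MonoidHom.id _ := fun a => by
    ext x; simp [ι, substLetter]
  have hKn : K.Nonempty := by
    refine ⟨pure (FreeMonoid.of none) * w.map ι, ?_, ?_⟩
    · change ∀ᶠ x in ((pure (FreeMonoid.of none) * w.map ι : Ultrafilter _) : Filter _),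
        x ∈ leftVariableWords A
      rw [Ultrafilter.eventually_mul]
      exact Filter.eventually_pure.2 (Filter.Eventually.of_forall fun m => ⟨m, rfl⟩)
    · refine Set.mem_iInter.2 fun a => ?_
      rw [Set.mem_preimage, Ultrafilter.map_mul_monoidHom, Ultrafilter.map_map,
        ← MonoidHom.coe_comp, hι]
      exact hmul _ _ (by simpa using hw)
  obtain ⟨v, hv, hvv⟩ := exists_idempotent_in_compact_subsemigroup
    Ultrafilter.continuous_mul_left K hKn hKc.isCompact (fun x hx y hy => by
      refine ⟨?_, Set.mem_iInter.2 fun a => ?_⟩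
      · change ∀ᶠ z in ((x * y : Ultrafilter _) : Filter _), z ∈ leftVariableWords A
        rw [Ultrafilter.eventually_mul]
        filter_upwards [hx.1] with m hm
        exact Filter.Eventually.of_forall fun m' => mul_mem_leftVariableWords hm
      · rw [Set.mem_preimage, Ultrafilter.map_mul_monoidHom]
        exact hmul _ _ (Set.mem_iInter.1 hy.2 a))
  refine ⟨v, hv.1, fun a b => hid _ (Set.mem_iInter.1 hv.2 a) _ (Set.mem_iInter.1 hv.2 b) ?_⟩
  rw [← Ultrafilter.map_mul_monoidHom, hvv]

/-- The word obtained by substituting successive letters in consecutive variable words of the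
sequence `w`, starting from the index `i`. -/
def substSeq (w : ℕ → FreeMonoid (Option A)) : ℕ → List A → FreeMonoid A
  | _, [] => 1
  | i, a :: l => substLetter a (w i) * substSeq w (i + 1) l

theorem substSeq_append (w : ℕ → FreeMonoid (Option A)) (i : ℕ) (l : List A) (a : A) :
    substSeq w i (l ++ [a]) = substSeq w i l * substLetter a (w (i + l.length)) := by
  induction l generalizing i with
  | nil => simp [substSeq]
  | cons b l ih => simp [substSeq, ih, mul_assoc, add_assoc, add_comm 1]

theorem exists_substSeq_mem [Finite A] (v : Ultrafilter (FreeMonoid (Option A)))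
    (hv : leftVariableWords A ∈ v)
    (hm : ∀ a b : A, v.map (substLetter a) * v.map (substLetter b) = v.map (substLetter a))
    (a₀ : A) (P : Set (FreeMonoid A)) (hP : P ∈ v.map (substLetter a₀)) :
    ∃ (w₀ : FreeMonoid A) (w : ℕ → FreeMonoid (Option A)), (∀ i, w i ∈ leftVariableWords A) ∧
      ∀ l : List A, w₀ * substSeq w 0 l ∈ P := by
  let Q : Set (FreeMonoid A) := {x ∈ P | ∀ a, ∀ᶠ y in v, x * substLetter a y ∈ P}
  have key : ∀ a b (R : FreeMonoid A → Prop), (∀ᶠ y in v, R (substLetter a y)) →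
      ∀ᶠ y in v, ∀ᶠ z in v, R (substLetter a y * substLetter b z) := by
    intro a b R hR
    have h1 : ∀ᶠ y in ((v.map (substLetter a) : Ultrafilter _) : Filter _), R y := hR
    rw [← hm a b, Ultrafilter.eventually_mul] at h1
    exact h1
  have hQ : ∀ x ∈ Q, ∀ a, ∀ᶠ y in v, x * substLetter a y ∈ Q := by
    intro x hx a
    refine (hx.2 a).and (Filter.eventually_all.2 fun b => ?_)
    simpa only [mul_assoc] using key a b (fun z => x * z ∈ P) (hx.2 a)
  obtain ⟨y₀, hy₀⟩ : ∃ y, substLetter a₀ y ∈ Q := by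
    have h1 : ∀ᶠ y in v, substLetter a₀ y ∈ Q :=
      Filter.Eventually.and hP (Filter.eventually_all.2 fun b => key a₀ b (· ∈ P) hP)
    exact h1.exists
  have step : ∀ F : Set (FreeMonoid A), ∃ y ∈ leftVariableWords A, F.Finite → F ⊆ Q →
      ∀ x ∈ F, ∀ a, x * substLetter a y ∈ Q := by
    intro F
    by_cases hF : F.Finite ∧ F ⊆ Q
    · have h1 : ∀ᶠ y in v, ∀ x ∈ F, ∀ a, x * substLetter a y ∈ Q :=
        (Filter.eventually_all_finite hF.1).2 fun x hx =>
          Filter.eventually_all.2 fun a => hQ x (hF.2 hx) a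
      obtain ⟨y, hy, hy'⟩ := (h1.and hv).exists
      exact ⟨y, hy', fun _ _ => hy⟩
    · exact ⟨FreeMonoid.of none * 1, ⟨1, rfl⟩, fun h h' => absurd ⟨h, h'⟩ hF⟩
  choose y hyv hy using step
  let F : ℕ → Set (FreeMonoid A) := fun n => Nat.rec {substLetter a₀ y₀}
    (fun _ G => Set.image2 (fun x a => x * substLetter a (y G)) G Set.univ) n
  have hF : ∀ n, (F n).Finite ∧ F n ⊆ Q := by
    intro n
    induction n with
    | zero => exact ⟨Set.finite_singleton _, Set.singleton_subset_iff.2 hy₀⟩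
    | succ n ih =>
      refine ⟨ih.1.image2 _ Set.finite_univ, ?_⟩
      rintro _ ⟨x, hx, a, -, rfl⟩
      exact hy _ ih.1 ih.2 x hx a
  refine ⟨substLetter a₀ y₀, fun n => y (F n), fun i => hyv _, fun l => ?_⟩
  suffices h : substLetter a₀ y₀ * substSeq (fun n => y (F n)) 0 l ∈ F l.length from
    ((hF _).2 h).1
  induction l using List.reverseRecOn with
  | nil => simp [substSeq, F]
  | append_singleton l a ih =>
    rw [substSeq_append, ← mul_assoc, List.length_append, zero_add]
    exact ⟨_, ih, a, trivial, rfl⟩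

/-- **Carlson–Simpson theorem** for left-variable words and two colours. -/
theorem exists_substSeq_homogeneous [Finite A] [Nonempty A] (P : Set (FreeMonoid A)) :
    ∃ (w₀ : FreeMonoid A) (w : ℕ → FreeMonoid (Option A)), (∀ i, w i ∈ leftVariableWords A) ∧
      ((∀ l : List A, w₀ * substSeq w 0 l ∈ P) ∨ ∀ l : List A, w₀ * substSeq w 0 l ∉ P) := by
  obtain ⟨v, hv, hm⟩ := exists_ultrafilter_leftVariableWords A
  obtain ⟨a₀⟩ := ‹Nonempty A›
  rcases (v.map (substLetter a₀)).mem_or_compl_mem P with hP | hP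
  · obtain ⟨w₀, w, hw, h⟩ := exists_substSeq_mem v hv hm a₀ P hP
    exact ⟨w₀, w, hw, Or.inl h⟩
  · obtain ⟨w₀, w, hw, h⟩ := exists_substSeq_mem v hv hm a₀ Pᶜ hP
    exact ⟨w₀, w, hw, Or.inr h⟩

end CarlsonSimpson

/-- Strong embeddings of `2^{<ω}` into itself: level-preserving maps such that `f (s ++ [b])`
extends `f s ++ [b]`. Their ranges are the infinite strong subtrees. -/
structure StrongEmb where
  toFun : List Bool → List Bool
  length_eq' : ∀ s t, s.length = t.length → (toFun s).length = (toFun t).length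
  append_prefix' : ∀ s b, toFun s ++ [b] <+: toFun (s ++ [b])

namespace StrongEmb

instance : FunLike StrongEmb (List Bool) (List Bool) where
  coe := toFun
  coe_injective f g h := by cases f; cases g; congr

@[ext] theorem ext {f g : StrongEmb} (h : ∀ s, f s = g s) : f = g := DFunLike.ext _ _ h

theorem length_eq (f : StrongEmb) {s t : List Bool} (h : s.length = t.length) :
    (f s).length = (f t).length := f.length_eq' s t h

theorem append_prefix (f : StrongEmb) (s : List Bool) (b : Bool) :
    f s ++ [b] <+: f (s ++ [b]) := f.append_prefix' s b

theorem prefix_append (f : StrongEmb) (s t : List Bool) : f s <+: f (s ++ t) := by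
  induction t using List.reverseRecOn with
  | nil => simp
  | append_singleton t b ih =>
    rw [← List.append_assoc]
    exact ih.trans ((List.prefix_append _ _).trans (f.append_prefix _ _))

theorem prefix_map (f : StrongEmb) {s t : List Bool} (h : s <+: t) : f s <+: f t := by
  obtain ⟨r, rfl⟩ := h
  exact f.prefix_append s r

theorem append_prefix_of_prefix (f : StrongEmb) {s t : List Bool} {b : Bool}
    (h : s ++ [b] <+: t) : f s ++ [b] <+: f t :=
  (f.append_prefix s b).trans (f.prefix_map h)

theorem length_lt_append (f : StrongEmb) (s : List Bool) (b : Bool) :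
    (f s).length < (f (s ++ [b])).length := by
  have := (f.append_prefix s b).length_le
  simp at this
  omega

theorem length_strictMono (f : StrongEmb) :
    StrictMono fun n => (f (List.replicate n false)).length := by
  refine strictMono_nat_of_lt_succ fun n => ?_
  rw [List.replicate_succ']
  exact f.length_lt_append _ _

theorem length_eq_replicate (f : StrongEmb) (s : List Bool) :
    (f s).length = (f (List.replicate s.length false)).length := f.length_eq (by simp)

theorem length_lt_iff (f : StrongEmb) {s t : List Bool} :
    (f s).length < (f t).length ↔ s.length < t.length := by
  rw [f.length_eq_replicate s, f.length_eq_replicate t]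
  exact f.length_strictMono.lt_iff_lt

theorem length_eq_iff (f : StrongEmb) {s t : List Bool} :
    (f s).length = (f t).length ↔ s.length = t.length := by
  rw [f.length_eq_replicate s, f.length_eq_replicate t]
  exact f.length_strictMono.injective.eq_iff

theorem length_le (f : StrongEmb) (s : List Bool) : s.length ≤ (f s).length := by
  rw [f.length_eq_replicate s]
  exact f.length_strictMono.le_apply

theorem append_prefix_of_map {f : StrongEmb} {s t : List Bool} {b : Bool} (hst : s <+: t)
    (h : f s ++ [b] <+: f t) : s ++ [b] <+: t := by
  obtain ⟨_ | ⟨c, r⟩, rfl⟩ := hst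
  · have := h.length_le
    simp at this
  · have h1 : f s ++ [c] <+: f (s ++ c :: r) := f.append_prefix_of_prefix ⟨r, by simp⟩
    have h2 := (List.prefix_of_prefix_length_le h h1 (by simp)).eq_of_length (by simp)
    obtain rfl : b = c := by simpa using h2
    exact ⟨r, by simp⟩

theorem prefix_iff (f : StrongEmb) {s t : List Bool} : f s <+: f t ↔ s <+: t := by
  refine ⟨fun h => ?_, f.prefix_map⟩
  induction s using List.reverseRecOn with
  | nil => exact List.nil_prefix
  | append_singleton s b ih =>
    exact append_prefix_of_map (ih ((f.prefix_append s [b]).trans h))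
      ((f.append_prefix s b).trans h)

theorem append_prefix_iff (f : StrongEmb) {s t : List Bool} {b : Bool} :
    f s ++ [b] <+: f t ↔ s ++ [b] <+: t :=
  ⟨fun h => append_prefix_of_map (f.prefix_iff.1 ((List.prefix_append _ _).trans h)) h,
    f.append_prefix_of_prefix⟩

theorem injective (f : StrongEmb) : Function.Injective f := fun _ _ h =>
  (f.prefix_iff.1 (h ▸ List.prefix_rfl)).eq_of_length (f.length_eq_iff.1 (h ▸ rfl))

instance : Monoid StrongEmb where
  mul f g := ⟨fun s => f (g s), fun _ _ h => f.length_eq (g.length_eq h),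
    fun s b => f.append_prefix_of_prefix (g.append_prefix s b)⟩
  one := ⟨id, fun _ _ h => h, fun _ _ => List.prefix_rfl⟩
  mul_assoc _ _ _ := rfl
  one_mul _ := rfl
  mul_one _ := rfl

@[simp] theorem mul_apply (f g : StrongEmb) (s : List Bool) : (f * g) s = f (g s) := rfl

@[simp] theorem one_apply (s : List Bool) : (1 : StrongEmb) s = s := rfl

/-- The strong embeddings that fix all nodes of length less than `n`. -/
def fixing (n : ℕ) : Submonoid StrongEmb where
  carrier := {f | ∀ s : List Bool, s.length < n → f s = s}
  one_mem' _ _ := rfl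
  mul_mem' {f g} hf hg s hs := by rw [mul_apply, hg s hs, hf s hs]

theorem fixing_antitone : Antitone fixing := fun _ _ h _ hf s hs => hf s (hs.trans_le h)

theorem prefix_of_mem_fixing {n : ℕ} {f : StrongEmb} (hf : f ∈ fixing n) {u : List Bool}
    (hu : u.length ≤ n) (t : List Bool) : u <+: f (u ++ t) := by
  refine List.IsPrefix.trans ?_ (f.prefix_append u t)
  induction u using List.reverseRecOn with
  | nil => exact List.nil_prefix
  | append_singleton u b =>
    have := f.append_prefix u b
    rwa [hf u (by simp at hu; omega)] at this

theorem eq_append_drop {n : ℕ} {f : StrongEmb} (hf : f ∈ fixing n) {u : List Bool}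
    (hu : u.length = n) (t : List Bool) : u ++ (f (u ++ t)).drop n = f (u ++ t) := by
  obtain ⟨r, hr⟩ := prefix_of_mem_fixing hf hu.le t
  rw [← hr, ← hu, List.drop_left]

/-- The strong embedding that fixes the nodes of length less than `n` and acts by `h u` above each
node `u` of length `n`. -/
def glue (n : ℕ) (h : List Bool → List Bool → List Bool)
    (h₁ : ∀ u v : List Bool, u.length = n → v.length = n → ∀ s t : List Bool,
      s.length = t.length → (h u s).length = (h v t).length)
    (h₂ : ∀ u : List Bool, u.length = n → ∀ s b, h u s ++ [b] <+: h u (s ++ [b])) :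
    StrongEmb where
  toFun s := if s.length < n then s else s.take n ++ h (s.take n) (s.drop n)
  length_eq' s t hst := by
    by_cases hs : s.length < n
    · simp [hst ▸ hs, hst]
    · have ht : ¬ t.length < n := hst ▸ hs
      simp only [hs, ht, if_false, List.length_append]
      rw [h₁ (s.take n) (t.take n) (by simp; omega) (by simp; omega) _ (t.drop n) (by simp [hst])]
      simp [hst]
  append_prefix' s b := by
    by_cases hs : s.length < n
    · by_cases hs' : s.length + 1 < n
      · simp [hs, hs']
      · have : (s ++ [b]).length = n := by simp; omega
        have h3 : ¬ s.length + 1 < n := hs'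
        simp only [hs, if_true, List.length_append, List.length_singleton, h3, if_false]
        rw [List.take_of_length_le this.le]
        exact List.prefix_append _ _
    · have hs' : ¬ (s ++ [b]).length < n := by simp; omega
      simp only [hs, hs', if_false]
      rw [List.take_append_of_le_length (by omega), List.drop_append_of_le_length (by omega),
        List.append_assoc, List.prefix_append_right_inj]
      exact h₂ _ (by simp; omega) _ _

variable {n : ℕ} {h : List Bool → List Bool → List Bool}
    {h₁ : ∀ u v : List Bool, u.length = n → v.length = n → ∀ s t : List Bool,
      s.length = t.length → (h u s).length = (h v t).length}
    {h₂ : ∀ u : List Bool, u.length = n → ∀ s b, h u s ++ [b] <+: h u (s ++ [b])}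

theorem glue_mem_fixing : glue n h h₁ h₂ ∈ fixing n := fun _ hs => if_pos hs

theorem glue_append {u : List Bool} (hu : u.length = n) (t : List Bool) :
    glue n h h₁ h₂ (u ++ t) = u ++ h u t := by
  have : ¬ (u ++ t).length < n := by simp; omega
  change (if _ then _ else _) = _
  rw [if_neg this, List.take_append_of_le_length hu.ge, List.take_of_length_le hu.le,
    List.drop_append_of_le_length hu.ge, List.drop_of_length_le hu.le, List.nil_append]

theorem ext_append (n : ℕ) {f g : StrongEmb} (h : ∀ s : List Bool, s.length < n → f s = g s)
    (h' : ∀ u t : List Bool, u.length = n → f (u ++ t) = g (u ++ t)) : f = g := by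
  ext1 s
  by_cases hs : s.length < n
  · exact h s hs
  · rw [← List.take_append_drop n s]
    exact h' _ _ (by simp; omega)

/-- The strong embedding that agrees with `f` up to level `n` and has no gaps above. -/
def hat (n : ℕ) (f : StrongEmb) : StrongEmb where
  toFun s := f (s.take n) ++ s.drop n
  length_eq' s t hst := by
    rw [List.length_append, List.length_append, f.length_eq (t := t.take n) (by simp [hst])]
    simp [hst]
  append_prefix' s b := by
    by_cases hs : s.length < n
    · rw [List.take_of_length_le hs.le, List.drop_of_length_le hs.le,
        List.take_of_length_le (by simp; omega), List.drop_of_length_le (by simp; omega)]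
      simpa using f.append_prefix s b
    · rw [List.take_append_of_le_length (by omega), List.drop_append_of_le_length (by omega),
        List.append_assoc]

theorem hat_apply_of_length_le {n : ℕ} (f : StrongEmb) {s : List Bool} (hs : s.length ≤ n) :
    hat n f s = f s := by
  change f (s.take n) ++ s.drop n = f s
  rw [List.take_of_length_le hs, List.drop_of_length_le hs, List.append_nil]

theorem hat_append {n : ℕ} (f : StrongEmb) {u : List Bool} (hu : u.length = n) (t : List Bool) :
    hat n f (u ++ t) = f u ++ t := by
  change f ((u ++ t).take n) ++ (u ++ t).drop n = _
  rw [List.take_append_of_le_length hu.ge, List.take_of_length_le hu.le,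
    List.drop_append_of_le_length hu.ge, List.drop_of_length_le hu.le, List.nil_append]

theorem hat_mem_fixing {n k : ℕ} (hkn : k ≤ n + 1) {f : StrongEmb} (hf : f ∈ fixing k) :
    hat n f ∈ fixing k := fun s hs => by
  rw [hat_apply_of_length_le f (by omega), hf s hs]

theorem eq_append_drop_length (f : StrongEmb) (u t : List Bool) :
    f u ++ (f (u ++ t)).drop (f u).length = f (u ++ t) := by
  obtain ⟨r, hr⟩ := f.prefix_append u t
  rw [← hr, List.drop_left]

theorem exists_eq_hat_mul (n : ℕ) (f : StrongEmb) : ∃ q ∈ fixing (n + 1), f = hat n f * q := by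
  let h : List Bool → List Bool → List Bool := fun u t => (f (u ++ t)).drop (f u).length
  have h₁ : ∀ u v : List Bool, u.length = n → v.length = n → ∀ s t : List Bool,
      s.length = t.length → (h u s).length = (h v t).length := by
    intro u v hu hv s t hst
    simp only [h, List.length_drop]
    rw [f.length_eq (hu.trans hv.symm),
      f.length_eq (s := u ++ s) (t := v ++ t) (by simp [hu, hv, hst])]
  have h₂ : ∀ u : List Bool, u.length = n → ∀ s b, h u s ++ [b] <+: h u (s ++ [b]) := by
    intro u hu s b
    rw [← List.prefix_append_right_inj (f u), ← List.append_assoc, eq_append_drop_length,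
      eq_append_drop_length, ← List.append_assoc]
    exact f.append_prefix _ _
  refine ⟨glue n h h₁ h₂, fun s hs => ?_, ext_append n (fun s hs => ?_) fun u t hu => ?_⟩
  · rcases (Nat.lt_succ_iff.1 hs).lt_or_eq with hs | hs
    · exact glue_mem_fixing s hs
    · have := glue_append (h₁ := h₁) (h₂ := h₂) hs []
      simpa [h] using this
  · rw [mul_apply, glue_mem_fixing s hs, hat_apply_of_length_le f hs.le]
  · rw [mul_apply, glue_append hu, hat_append f hu]
    exact (eq_append_drop_length f u t).symm

theorem exists_mul_eq_mul {n d : ℕ} {a : StrongEmb}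
    (ha : ∀ u : List Bool, u.length = n → (a u).length = d ∧ ∀ t, a (u ++ t) = a u ++ t)
    {g : StrongEmb} (hg : g ∈ fixing d) : ∃ h ∈ fixing n, g * a = a * h := by
  have h₁ : ∀ u v : List Bool, u.length = n → v.length = n → ∀ s t : List Bool,
      s.length = t.length → ((g (a u ++ s)).drop d).length = ((g (a v ++ t)).drop d).length := by
    intro u v hu hv s t hst
    rw [List.length_drop, List.length_drop,
      g.length_eq (s := a u ++ s) (t := a v ++ t) (by simp [(ha u hu).1, (ha v hv).1, hst])]
  have h₂ : ∀ u : List Bool, u.length = n → ∀ s b,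
      (g (a u ++ s)).drop d ++ [b] <+: (g (a u ++ (s ++ [b]))).drop d := by
    intro u hu s b
    rw [← List.prefix_append_right_inj (a u), ← List.append_assoc,
      eq_append_drop hg (ha u hu).1, eq_append_drop hg (ha u hu).1, ← List.append_assoc]
    exact g.append_prefix _ _
  refine ⟨glue n (fun u t => (g (a u ++ t)).drop d) h₁ h₂, glue_mem_fixing,
    ext_append n (fun s hs => ?_) fun u t hu => ?_⟩
  · rw [mul_apply, mul_apply, glue_mem_fixing s hs, hg]
    rw [← (ha (List.replicate n false) (by simp)).1, a.length_lt_iff]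
    simpa using hs
  · rw [mul_apply, mul_apply, glue_append hu, (ha u hu).2, (ha u hu).2,
      eq_append_drop hg (ha u hu).1]

theorem exists_mul_eq_mul' {n d : ℕ} {a : StrongEmb}
    (ha : ∀ u : List Bool, u.length = n → (a u).length = d ∧ ∀ t, a (u ++ t) = a u ++ t)
    {h : StrongEmb} (hh : h ∈ fixing n) : ∃ g ∈ fixing d, g * a = a * h := by
  classical
  let π : List Bool → List Bool := fun v =>
    if hv : ∃ u : List Bool, u.length = n ∧ a u = v then hv.choose else List.replicate n false
  have hπ : ∀ v, (π v).length = n := fun v => by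
    by_cases hv : ∃ u : List Bool, u.length = n ∧ a u = v
    · simp only [π, hv, dif_pos]; exact hv.choose_spec.1
    · simp [π, hv]
  have hπa : ∀ u : List Bool, u.length = n → π (a u) = u := fun u hu => by
    have hv : ∃ w : List Bool, w.length = n ∧ a w = a u := ⟨u, hu, rfl⟩
    simp only [π, hv, dif_pos]
    exact a.injective hv.choose_spec.2
  have h₁ : ∀ u v : List Bool, u.length = d → v.length = d → ∀ s t : List Bool,
      s.length = t.length → ((h (π u ++ s)).drop n).length = ((h (π v ++ t)).drop n).length := by
    intro u v _ _ s t hst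
    rw [List.length_drop, List.length_drop,
      h.length_eq (s := π u ++ s) (t := π v ++ t) (by simp [hπ, hst])]
  have h₂ : ∀ u : List Bool, u.length = d → ∀ s b,
      (h (π u ++ s)).drop n ++ [b] <+: (h (π u ++ (s ++ [b]))).drop n := by
    intro u _ s b
    rw [← List.prefix_append_right_inj (π u), ← List.append_assoc,
      eq_append_drop hh (hπ u), eq_append_drop hh (hπ u), ← List.append_assoc]
    exact h.append_prefix _ _
  refine ⟨glue d (fun v t => (h (π v ++ t)).drop n) h₁ h₂, glue_mem_fixing,
    ext_append n (fun s hs => ?_) fun u t hu => ?_⟩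
  · rw [mul_apply, mul_apply, hh s hs, glue_mem_fixing]
    rw [← (ha (List.replicate n false) (by simp)).1, a.length_lt_iff]
    simpa using hs
  · rw [mul_apply, mul_apply, (ha u hu).2, glue_append (ha u hu).1, hπa u hu, ← (ha u hu).2,
      eq_append_drop hh hu]

end StrongEmb

theorem FreeMonoid.map_substLetter {A B : Type*} (φ : A → B) (a : A)
    (x : FreeMonoid (Option A)) :
    FreeMonoid.map φ (substLetter a x) =
      substLetter (φ a) (FreeMonoid.map (Option.map φ) x) := by
  have : (FreeMonoid.map φ).comp (substLetter a) =
      (substLetter (φ a)).comp (FreeMonoid.map (Option.map φ)) := by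
    ext o
    cases o <;> simp [substLetter]
  exact DFunLike.congr_fun this x

theorem FreeMonoid.map_substSeq {A B : Type*} (φ : A → B) (w : ℕ → FreeMonoid (Option A)) (i : ℕ)
    (l : List A) :
    FreeMonoid.map φ (substSeq w i l) =
      substSeq (fun j => FreeMonoid.map (Option.map φ) (w j)) i (l.map φ) := by
  induction l generalizing i with
  | nil => simp [substSeq]
  | cons a l ih => simp [substSeq, ih, FreeMonoid.map_substLetter]

theorem length_substLetter {A : Type*} (a : A) (x : FreeMonoid (Option A)) :
    (substLetter a x).length = x.length := List.length_map _

theorem length_substSeq {A B : Type*} {w : ℕ → FreeMonoid (Option A)}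
    {w' : ℕ → FreeMonoid (Option B)} (hw : ∀ i, (w i).length = (w' i).length) (i : ℕ)
    {l : List A} {l' : List B} (hl : l.length = l'.length) :
    (substSeq w i l).length = (substSeq w' i l').length := by
  induction l generalizing i l' with
  | nil =>
    obtain rfl := List.length_eq_zero_iff.1 hl.symm
    simp [substSeq]
  | cons a l ih =>
    obtain _ | ⟨b, l'⟩ := l'
    · simp at hl
    · simp only [substSeq, FreeMonoid.length_mul, length_substLetter, hw,
        ih (i + 1) (Nat.succ.inj hl)]

namespace StrongEmb

/-- The pigeonhole principle for one-step extensions: the strong-subtree form of the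
Halpern–Läuchli theorem. -/
theorem exists_hat_homogeneous (C : Set StrongEmb) (n : ℕ) :
    ∃ g ∈ fixing n,
      (∀ f ∈ fixing n, hat n (g * f) ∈ C) ∨ (∀ f ∈ fixing n, hat n (g * f) ∉ C) := by
  let A := {u : List Bool // u.length = n} → Bool
  have : Finite {u : List Bool // u.length = n} := (List.finite_length_eq Bool n).to_subtype
  let ev : List Bool → A → Bool := fun u a => if hu : u.length = n then a ⟨u, hu⟩ else false
  let c : FreeMonoid A → StrongEmb := fun x =>
    glue n (fun u t => x.toList.map (ev u) ++ t) (by intro u v _ _ s t h; simp [h])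
      (by intro u _ s b; simp)
  obtain ⟨w₀, w, hw, hP⟩ := exists_substSeq_homogeneous (c ⁻¹' C)
  let w' : List Bool → ℕ → FreeMonoid (Option Bool) :=
    fun u i => FreeMonoid.map (Option.map (ev u)) (w i)
  let h : List Bool → List Bool → List Bool := fun u t =>
    (FreeMonoid.map (ev u) w₀ * substSeq (w' u) 0 t).toList
  have h₁ : ∀ u v : List Bool, u.length = n → v.length = n → ∀ s t : List Bool,
      s.length = t.length → (h u s).length = (h v t).length := by
    intro u v _ _ s t hst
    change FreeMonoid.length _ = FreeMonoid.length _
    rw [FreeMonoid.length_mul, FreeMonoid.length_mul]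
    congr 1
    · exact (List.length_map _).trans (List.length_map _).symm
    · exact length_substSeq (fun i => (List.length_map _).trans (List.length_map _).symm) 0 hst
  have h₂ : ∀ u : List Bool, u.length = n → ∀ s b, h u s ++ [b] <+: h u (s ++ [b]) := by
    intro u _ s b
    obtain ⟨y, hy⟩ := hw (0 + s.length)
    refine ⟨(substLetter b (FreeMonoid.map (Option.map (ev u)) y)).toList, ?_⟩
    simp only [h, substSeq_append, w', ← hy]
    simp [substLetter]
  have key : ∀ f ∈ fixing n, ∃ l, hat n (glue n h h₁ h₂ * f) = c (w₀ * substSeq w 0 l) := by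
    intro f hf
    let l : List A := (List.range ((f (List.replicate n false)).length - n)).map
      fun j u => ((f u.1).drop n).getD j false
    have hl : ∀ u : List Bool, u.length = n → l.map (ev u) = (f u).drop n := by
      intro u hu
      have hlen : (f u).length = (f (List.replicate n false)).length := f.length_eq (by simp [hu])
      refine List.ext_getElem (by simp [l, hlen]) fun i hi hi' => ?_
      simp only [List.length_drop] at hi'
      simp only [List.getElem_map, List.getElem_range, List.getElem_drop, l, ev, hu, dif_pos]
      rw [List.getD_eq_getElem _ _ (by simpa using hi'), List.getElem_drop]
    refine ⟨l, ext_append n (fun s hs => ?_) fun u t hu => ?_⟩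
    · rw [hat_apply_of_length_le _ hs.le, mul_apply, hf s hs, glue_mem_fixing s hs,
        glue_mem_fixing s hs]
    · have h3 := eq_append_drop hf hu []
      rw [List.append_nil] at h3
      rw [hat_append _ hu, glue_append hu, mul_apply, ← h3, glue_append hu, List.append_assoc]
      congr 2
      have h4 : FreeMonoid.map (ev u) (w₀ * substSeq w 0 l) =
          FreeMonoid.map (ev u) w₀ * substSeq (w' u) 0 ((f u).drop n) := by
        rw [map_mul, FreeMonoid.map_substSeq, hl u hu]
      exact congrArg FreeMonoid.toList h4.symm
  refine ⟨glue n h h₁ h₂, glue_mem_fixing, hP.imp (fun hP f hf => ?_) fun hP f hf => ?_⟩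
  · obtain ⟨l, hl⟩ := key f hf
    exact hl ▸ hP l
  · obtain ⟨l, hl⟩ := key f hf
    exact hl ▸ hP l

/-- Partial products of a sequence of strong embeddings. -/
def partialProd (g : ℕ → StrongEmb) : ℕ → StrongEmb
  | 0 => 1
  | i + 1 => partialProd g i * g i

theorem partialProd_add (g : ℕ → StrongEmb) (i j : ℕ) :
    partialProd g (i + j) = partialProd g i * partialProd (fun m => g (i + m)) j := by
  induction j with
  | zero => rfl
  | succ j ih => rw [← add_assoc, partialProd, ih, partialProd, mul_assoc]

theorem partialProd_add_apply {g : ℕ → StrongEmb} {k : ℕ} (hg : ∀ i, g i ∈ fixing (k + i))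
    {s : List Bool} {m : ℕ} (hs : s.length < k + m) (j : ℕ) :
    partialProd g (m + j) s = partialProd g m s := by
  induction j with
  | zero => rfl
  | succ j ih => rw [← add_assoc, partialProd, mul_apply, hg (m + j) s (by omega), ih]

theorem exists_limit {g : ℕ → StrongEmb} {k : ℕ} (hg : ∀ i, g i ∈ fixing (k + i)) :
    ∃ G : StrongEmb, ∀ (s : List Bool) (m : ℕ), s.length < k + m → G s = partialProd g m s := by
  have key : ∀ (s : List Bool) (m : ℕ), s.length < k + m →
      partialProd g (s.length + 1) s = partialProd g m s := by
    intro s m hs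
    rw [← partialProd_add_apply hg hs (s.length + 1),
      ← partialProd_add_apply hg (m := s.length + 1) (by omega) m, add_comm]
  refine ⟨⟨fun s => partialProd g (s.length + 1) s, fun s t h => ?_, fun s b => ?_⟩, key⟩
  · simp only [h]
    exact length_eq _ h
  · rw [key s (s.length + 2) (by omega), List.length_append]
    exact append_prefix _ s b

theorem exists_limit_eq_mul {g : ℕ → StrongEmb} {k : ℕ} (hg : ∀ i, g i ∈ fixing (k + i)) :
    ∃ G ∈ fixing k, ∀ i, ∃ G' ∈ fixing (k + i), G = partialProd g i * G' := by
  obtain ⟨G, hG⟩ := exists_limit hg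
  refine ⟨G, fun s hs => hG s 0 hs, fun i => ?_⟩
  obtain ⟨G', hG'⟩ := exists_limit (g := fun m => g (i + m)) (k := k + i)
    fun j => by rw [add_assoc]; exact hg _
  refine ⟨G', fun s hs => hG' s 0 hs, ?_⟩
  ext1 s
  rw [hG s (i + (s.length + 1)) (by omega), mul_apply, hG' s (s.length + 1) (by omega),
    partialProd_add, mul_apply]

/-- `a` has no gaps above level `n`, and it maps level `n` to level `d`. -/
def GapFreeAbove (n d : ℕ) (a : StrongEmb) : Prop :=
  ∀ u : List Bool, u.length = n → (a u).length = d ∧ ∀ t, a (u ++ t) = a u ++ t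

theorem gapFreeAbove_hat (n : ℕ) (f : StrongEmb) :
    GapFreeAbove n (f (List.replicate n false)).length (hat n f) := fun u hu => by
  have h := hat_apply_of_length_le f hu.le
  rw [h]
  exact ⟨f.length_eq (by simp [hu]), hat_append f hu⟩

theorem GapFreeAbove.le {n d : ℕ} {a : StrongEmb} (ha : GapFreeAbove n d a) : n ≤ d := by
  have h := a.length_le (List.replicate n false)
  rwa [(ha _ (by simp)).1, List.length_replicate] at h

theorem finite_gapFreeAbove (n d : ℕ) : {a | GapFreeAbove n d a}.Finite := by
  have : Finite {s : List Bool // s.length ≤ d} := (List.finite_length_le Bool d).to_subtype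
  let F : StrongEmb → {s : List Bool // s.length ≤ d} → {s : List Bool // s.length ≤ d} :=
    fun a s => ⟨(a s).take d, by simp⟩
  refine Set.Finite.of_finite_image (f := F) (Set.toFinite _) fun a ha b hb hab => ?_
  have hle : ∀ c, GapFreeAbove n d c → ∀ s : List Bool, s.length ≤ n → (c s).length ≤ d := by
    intro c hc s hs
    rw [← (hc (List.replicate n false) (by simp)).1]
    by_contra! hlt
    rw [c.length_lt_iff] at hlt
    simp at hlt
    omega
  have heq : ∀ s : List Bool, s.length ≤ n → a s = b s := by
    intro s hs
    have h := congrArg Subtype.val (congrFun hab ⟨s, hs.trans ha.le⟩)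
    simpa only [F, List.take_of_length_le (hle a ha s hs),
      List.take_of_length_le (hle b hb s hs)] using h
  refine ext_append n (fun s hs => heq s hs.le) fun u t hu => ?_
  rw [(ha u hu).2, (hb u hu).2, heq u hu.le]

theorem exists_forall_gapFreeAbove {P : StrongEmb → ℕ → Prop}
    (hmono : ∀ b n, ∀ h ∈ fixing n, P b n → P (b * h) n)
    (hdense : ∀ b n, ∃ h ∈ fixing n, P (b * h) n) (b : StrongEmb) (d : ℕ) :
    ∃ g ∈ fixing d, ∀ n a, GapFreeAbove n d a → P (b * g * a) n := by
  have hfin : {p : ℕ × StrongEmb | GapFreeAbove p.1 d p.2}.Finite := by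
    refine ((Set.finite_Iic d).biUnion fun n _ =>
      (finite_gapFreeAbove n d).image (Prod.mk n)).subset ?_
    rintro ⟨n, a⟩ ha
    exact Set.mem_biUnion (Set.mem_Iic.2 (GapFreeAbove.le ha)) ⟨a, ha, rfl⟩
  suffices h : ∀ F : Set (ℕ × StrongEmb), F.Finite → (∀ p ∈ F, GapFreeAbove p.1 d p.2) →
      ∃ g ∈ fixing d, ∀ p ∈ F, P (b * g * p.2) p.1 by
    obtain ⟨g, hg, hg'⟩ := h _ hfin fun p hp => hp
    exact ⟨g, hg, fun n a ha => hg' (n, a) ha⟩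
  intro F hF
  induction F, hF using Set.Finite.induction_on with
  | empty => exact fun _ => ⟨1, one_mem _, by simp⟩
  | @insert p F _ _ ih =>
    intro hgap
    obtain ⟨g, hg, hgF⟩ := ih fun p hp => hgap p (Set.mem_insert_of_mem _ hp)
    obtain ⟨h, hh, hPh⟩ := hdense (b * g * p.2) p.1
    obtain ⟨g', hg', he⟩ := exists_mul_eq_mul' (hgap p (Set.mem_insert _ _)) hh
    refine ⟨g * g', mul_mem hg hg', fun q hq => ?_⟩
    rcases Set.mem_insert_iff.1 hq with rfl | hqF
    · rwa [← mul_assoc b, mul_assoc _ g', he, ← mul_assoc]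
    · obtain ⟨h', hh', he'⟩ := exists_mul_eq_mul (hgap q hq) hg'
      rw [← mul_assoc b, mul_assoc _ g', he', ← mul_assoc]
      exact hmono _ _ h' hh' (hgF q hqF)

/-- Fusion: a hereditary and dense property holds at all approximations of some `b * g`. -/
theorem exists_fusion {P : StrongEmb → ℕ → Prop}
    (hmono : ∀ b n, ∀ h ∈ fixing n, P b n → P (b * h) n)
    (hdense : ∀ b n, ∃ h ∈ fixing n, P (b * h) n) (b : StrongEmb) (k : ℕ) :
    ∃ g ∈ fixing k, ∀ f ∈ fixing k, ∀ n, k ≤ n → P (b * g * f) n := by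
  choose γ hγ hP using exists_forall_gapFreeAbove hmono hdense
  let q : ℕ → StrongEmb := fun i => Nat.rec b (fun j c => c * γ c (k + j)) i
  let g : ℕ → StrongEmb := fun i => γ (q i) (k + i)
  have hq : ∀ i, q i = b * partialProd g i := by
    intro i
    induction i with
    | zero => rfl
    | succ i ih =>
      change q i * g i = _
      rw [ih, partialProd, mul_assoc]
  obtain ⟨G, hG, hG'⟩ := exists_limit_eq_mul (g := g) (k := k) fun i => hγ _ _
  refine ⟨G, hG, fun f hf n hn => ?_⟩
  obtain ⟨r, hr, hfr⟩ := exists_eq_hat_mul n f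
  have hgap := gapFreeAbove_hat n f
  obtain ⟨i, hi⟩ := Nat.exists_eq_add_of_le (hn.trans hgap.le)
  rw [hi] at hgap
  obtain ⟨G', hGf, hGe⟩ := hG' (i + 1)
  obtain ⟨h, hh, he⟩ := exists_mul_eq_mul hgap (fixing_antitone (by omega) hGf)
  have : b * G * f = q i * g i * hat n f * (h * r) := by
    calc b * G * f = b * (partialProd g i * g i * G') * (hat n f * r) := by
          rw [← hfr, hGe, partialProd]
      _ = b * partialProd g i * g i * (G' * hat n f) * r := by simp only [mul_assoc]
      _ = _ := by rw [he, hq]; simp only [mul_assoc]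
  rw [this]
  exact hmono _ _ _ (mul_mem hh (fixing_antitone (Nat.le_succ n) hr)) (hP _ _ _ _ hgap)

theorem exists_fixing_subset_or_disjoint {X : Set StrongEmb}
    (hX : ∀ e ∈ X, ∃ k, ∀ f ∈ fixing k, e * f ∈ X) (b : StrongEmb) (k : ℕ) :
    ∃ g ∈ fixing k, (∀ f ∈ fixing k, b * g * f ∈ X) ∨ ∀ f ∈ fixing k, b * g * f ∉ X := by
  let acc : StrongEmb → ℕ → Prop := fun b n => ∀ m ∈ fixing n, b * m ∈ X
  let rej : StrongEmb → ℕ → Prop := fun b n => ∀ m ∈ fixing n, ¬ acc (b * m) n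
  have hacc : ∀ b n, ∀ h ∈ fixing n, acc b n → acc (b * h) n := fun b n h hh hb m hm => by
    rw [mul_assoc]; exact hb _ (mul_mem hh hm)
  have hrej : ∀ b n, ∀ h ∈ fixing n, rej b n → rej (b * h) n := fun b n h hh hb m hm => by
    rw [mul_assoc]; exact hb _ (mul_mem hh hm)
  have hnot : ∀ b n, rej b n → ¬ acc b n := fun b n hb => by
    simpa using hb 1 (one_mem _)
  have hdec := exists_fusion (P := fun b n => acc b n ∨ rej b n)
    (fun b n h hh => Or.imp (hacc b n h hh) (hrej b n h hh)) (fun b n => by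
      by_cases hb : rej b n
      · exact ⟨1, one_mem _, Or.inr (by simpa using hb)⟩
      · simp only [rej] at hb
        push Not at hb
        obtain ⟨m, hm, h⟩ := hb
        exact ⟨m, hm, Or.inl h⟩)
  have hext := exists_fusion
    (P := fun b n => acc b n ∨ (rej b n ∧ ∀ c ∈ fixing n, rej (b * c) (n + 1)))
    (fun b n h hh => Or.imp (hacc b n h hh) fun hb => ⟨hrej b n h hh hb.1, fun c hc => by
      rw [mul_assoc]; exact hb.2 _ (mul_mem hh hc)⟩) (fun b n => by
      obtain ⟨g, hg, hdg⟩ := hdec b n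
      have hdg1 : acc (b * g) n ∨ rej (b * g) n := by simpa using hdg 1 (one_mem _) n le_rfl
      rcases hdg1 with ha | hr
      · exact ⟨g, hg, Or.inl ha⟩
      obtain ⟨h, hh, hC⟩ := exists_hat_homogeneous {c | acc (b * g * c) (n + 1)} n
      refine ⟨g * h, mul_mem hg hh, Or.inr ⟨?_, fun c hc => ?_⟩⟩
      · rw [← mul_assoc]; exact hrej _ _ h hh hr
      rcases hC with hC | hC
      · refine absurd (fun m hm => ?_) (hr h hh)
        obtain ⟨r, hr', he⟩ := exists_eq_hat_mul n (h * m)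
        rw [mul_assoc, he, ← mul_assoc]
        exact hC m hm r hr'
      · obtain ⟨r, hr', he⟩ := exists_eq_hat_mul n (h * c)
        rw [← mul_assoc, mul_assoc, he, ← mul_assoc]
        exact hrej _ _ r hr' ((hdg (hat n (h * c))
          (hat_mem_fixing (Nat.le_succ n) (mul_mem hh hc)) (n + 1) (Nat.le_succ n)).resolve_left
          (hC c hc)))
  obtain ⟨g, hg, hgf⟩ := hext b k
  refine ⟨g, hg, ?_⟩
  by_cases ha : acc (b * g) k
  · exact Or.inl ha
  right
  have hall : ∀ n, k ≤ n → ∀ f ∈ fixing k, rej (b * g * f) n := by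
    intro n hn
    induction n, hn using Nat.le_induction with
    | base =>
      intro f hf
      have := (hgf 1 (one_mem _) k le_rfl).resolve_left (by simpa using ha)
      exact hrej _ _ f hf (by simpa using this.1)
    | succ n hn ih =>
      intro f hf
      have := (hgf f hf n hn).resolve_left (hnot _ _ (ih f hf))
      simpa using this.2 1 (one_mem _)
  intro f hf hfX
  obtain ⟨m, hm⟩ := hX _ hfX
  exact hnot _ _ (hall (max k m) (le_max_left _ _) f hf)
    fun c hc => hm c (fixing_antitone (le_max_right _ _) hc)

theorem exists_fixing_forall_mem {O : ℕ → Set StrongEmb}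
    (hO : ∀ i, ∀ e ∈ O i, ∃ k, ∀ f ∈ fixing k, e * f ∈ O i)
    (hd : ∀ i b k, ∃ f ∈ fixing k, b * f ∈ O i) (b : StrongEmb) (k : ℕ) :
    ∃ g ∈ fixing k, ∀ f ∈ fixing k, ∀ i, b * g * f ∈ O i := by
  have hdense : ∀ (F : Finset ℕ) b n, ∃ h ∈ fixing n, ∀ i ∈ F, ∀ m ∈ fixing n,
      b * h * m ∈ O i := by
    intro F
    induction F using Finset.induction_on with
    | empty => exact fun b n => ⟨1, one_mem _, by simp⟩
    | insert j F _ ih =>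
      intro b n
      obtain ⟨h, hh, hF⟩ := ih b n
      obtain ⟨g, hg, hj⟩ := exists_fixing_subset_or_disjoint (hO j) (b * h) n
      refine ⟨h * g, mul_mem hh hg, fun i hi m hm => ?_⟩
      rcases Finset.mem_insert.1 hi with rfl | hi
      · rcases hj with hj | hj
        · simpa only [mul_assoc] using hj m hm
        · obtain ⟨f, hf, hfO⟩ := hd i (b * h * g) n
          exact absurd hfO (hj f hf)
      · simpa only [mul_assoc] using hF i hi (g * m) (mul_mem hg hm)
  obtain ⟨g, hg, hgf⟩ := exists_fusion
    (P := fun b n => ∀ i ∈ Finset.range (n + 1), ∀ m ∈ fixing n, b * m ∈ O i)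
    (fun b n h hh hb i hi m hm => by rw [mul_assoc]; exact hb i hi _ (mul_mem hh hm))
    (fun b n => hdense _ b n) b k
  refine ⟨g, hg, fun f hf i => ?_⟩
  simpa using hgf f hf (max k i) (le_max_left _ _) i (by simp) 1 (one_mem _)

end StrongEmb

theorem List.eq_of_append_singleton_prefix {α : Type*} {r t : List α} {b c : α}
    (hb : r ++ [b] <+: t) (hc : r ++ [c] <+: t) : b = c := by
  simpa using (List.prefix_of_prefix_length_le hb hc (by simp)).eq_of_length (by simp)

theorem List.exists_append_singleton_prefix_of_lt {α : Type*} {r t : List α} (h : r <+: t)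
    (hlt : r.length < t.length) : ∃ b, r ++ [b] <+: t := by
  obtain ⟨_ | ⟨b, l⟩, rfl⟩ := h
  · simp at hlt
  · exact ⟨b, l, by simp⟩

theorem List.prefix_or_prefix_or_exists_branch {α : Type*} (s t : List α) :
    s <+: t ∨ t <+: s ∨ ∃ r b c, b ≠ c ∧ r ++ [b] <+: s ∧ r ++ [c] <+: t := by
  induction s generalizing t with
  | nil => exact Or.inl List.nil_prefix
  | cons a s ih =>
    obtain _ | ⟨a', t⟩ := t
    · exact Or.inr (Or.inl List.nil_prefix)
    · by_cases haa : a = a'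
      · subst haa
        simp only [List.cons_prefix_cons, true_and]
        refine (ih t).imp id (Or.imp id ?_)
        rintro ⟨r, b, c, hbc, hs, ht⟩
        exact ⟨a :: r, b, c, hbc, by simpa using hs, by simpa using ht⟩
      · exact Or.inr (Or.inr ⟨[], a, a', haa, by simp, by simp⟩)

namespace StrongEmb

theorem eq_map_take_of_prefix (e : StrongEmb) {u s t : List Bool} (hu : u <+: e t)
    (hs : u.length = (e s).length) : u = e (t.take s.length) := by
  have hle : s.length ≤ t.length := by
    have := hs ▸ hu.length_le
    contrapose! this
    exact e.length_lt_iff.2 this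
  have hlen : u.length = (e (t.take s.length)).length := by
    rw [hs, e.length_eq]
    simp [hle]
  exact (List.prefix_of_prefix_length_le hu (e.prefix_map (List.take_prefix _ _))
    hlen.le).eq_of_length hlen

theorem exists_eq_of_branch (e : StrongEmb) {u s t : List Bool} (hs : u ++ [false] <+: e s)
    (ht : u ++ [true] <+: e t) : ∃ r, r.length < s.length ∧ e r = u := by
  rcases List.prefix_or_prefix_or_exists_branch s t with h | h | ⟨r, b, c, hbc, hrs, hrt⟩
  · have := List.eq_of_append_singleton_prefix (hs.trans (e.prefix_map h)) ht
    simp at this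
  · have := List.eq_of_append_singleton_prefix hs (ht.trans (e.prefix_map h))
    simp at this
  · refine ⟨r, by have := hrs.length_le; simp at this; omega, ?_⟩
    have hes := e.append_prefix_of_prefix hrs
    have het := e.append_prefix_of_prefix hrt
    have hus : u <+: e s := (List.prefix_append _ _).trans hs
    have hut : u <+: e t := (List.prefix_append _ _).trans ht
    have hers : e r <+: e s := (List.prefix_append _ _).trans hes
    have hert : e r <+: e t := (List.prefix_append _ _).trans het
    rcases lt_trichotomy (e r).length u.length with hlt | heq | hlt
    · exact absurd (List.eq_of_append_singleton_prefix
        (List.prefix_of_prefix_length_le hes hus (by simpa using hlt))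
        (List.prefix_of_prefix_length_le het hut (by simpa using hlt))) hbc
    · exact (List.prefix_of_prefix_length_le hers hus heq.le).eq_of_length heq
    · have := List.eq_of_append_singleton_prefix
        (List.prefix_of_prefix_length_le hs hers (by simpa using hlt))
        (List.prefix_of_prefix_length_le ht hert (by simpa using hlt))
      simp at this

theorem isInfStrongTree_range (e : StrongEmb) : IsInfStrongTree (Set.range e) := by
  refine ⟨Set.range fun s => (e s).length, ?_, ⟨e [], [], rfl⟩, ?_, ?_, ?_, ?_, ?_⟩
  · refine Set.Infinite.mono ?_ (Set.infinite_range_of_injective e.length_strictMono.injective)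
    rintro _ ⟨n, rfl⟩
    exact ⟨_, rfl⟩
  · rintro _ ⟨s, rfl⟩
    exact ⟨s, rfl⟩
  · rintro u ⟨_, ⟨t, rfl⟩, hu⟩ ⟨s, hs⟩
    exact ⟨_, (e.eq_map_take_of_prefix hu hs.symm).symm⟩
  · rintro _ ⟨s, rfl⟩
    exact ⟨⟨_, ⟨_, rfl⟩, e.append_prefix s _⟩, ⟨_, ⟨_, rfl⟩, e.append_prefix s _⟩⟩
  · rintro u - ⟨⟨_, ⟨s, rfl⟩, hs⟩, ⟨_, ⟨t, rfl⟩, ht⟩⟩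
    obtain ⟨r, -, rfl⟩ := e.exists_eq_of_branch hs ht
    exact ⟨r, rfl⟩
  · rintro _ ⟨s, rfl⟩
    exact ⟨e s, ⟨s, rfl⟩, rfl⟩

theorem isFinStrongTree_image (e : StrongEmb) (k : ℕ) :
    ∃ L, IsFinStrongTree (e '' {s | s.length < k + 1}) L := by
  have hL : ∀ l, l ∈ (Finset.range (k + 1)).image
      (fun n => (e (List.replicate n false)).length) ↔
      ∃ s : List Bool, s.length < k + 1 ∧ (e s).length = l := by
    intro l
    simp only [Finset.mem_image, Finset.mem_range]
    constructor
    · rintro ⟨n, hn, rfl⟩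
      exact ⟨_, by simpa using hn, rfl⟩
    · rintro ⟨s, hs, rfl⟩
      exact ⟨s.length, hs, (e.length_eq_replicate s).symm⟩
  refine ⟨(Finset.range (k + 1)).image fun n => (e (List.replicate n false)).length,
    ⟨e [], [], by simp, rfl⟩, ?_, ?_, ?_, ?_, ?_⟩
  · rintro _ ⟨s, hs, rfl⟩
    exact (hL _).2 ⟨s, hs, rfl⟩
  · rintro u ⟨_, ⟨t, ht, rfl⟩, hu⟩ hul
    obtain ⟨s, hs, hsl⟩ := (hL _).1 hul
    refine ⟨_, ?_, (e.eq_map_take_of_prefix hu hsl.symm).symm⟩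
    exact (List.take_prefix _ _).length_le.trans_lt ht
  · rintro _ ⟨s, hs, rfl⟩ ⟨l, hl, hlt⟩
    obtain ⟨t, ht, rfl⟩ := (hL _).1 hl
    have hst := e.length_lt_iff.1 hlt
    have h : ∀ b, e s ++ [b] ∈ downcl (e '' {s | s.length < k + 1}) := fun b =>
      ⟨_, ⟨s ++ [b], by simp at ht ⊢; omega, rfl⟩, e.append_prefix s b⟩
    exact ⟨h _, h _⟩
  · rintro u - ⟨⟨_, ⟨s, hs, rfl⟩, hus⟩, ⟨_, ⟨t, ht, rfl⟩, hut⟩⟩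
    obtain ⟨r, hr, rfl⟩ := e.exists_eq_of_branch hus hut
    exact (hL _).2 ⟨r, hr.trans hs, rfl⟩
  · intro l hl
    obtain ⟨s, hs, rfl⟩ := (hL _).1 hl
    exact ⟨_, ⟨s, hs, rfl⟩, rfl⟩

theorem rk_range (e : StrongEmb) (k : ℕ) : rk k (Set.range e) = e '' {s | s.length < k} := by
  have hcard : ∀ s : List Bool,
      {x | x ∈ Set.range e ∧ x <+: e s ∧ x ≠ e s}.ncard = s.length := by
    intro s
    have : {x | x ∈ Set.range e ∧ x <+: e s ∧ x ≠ e s} =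
        (fun i => e (s.take i)) '' (Finset.range s.length : Set ℕ) := by
      ext x
      simp only [Set.mem_image, Finset.coe_range, Set.mem_Iio]
      constructor
      · rintro ⟨⟨r, rfl⟩, hr, hne⟩
        have hrs := e.prefix_iff.1 hr
        refine ⟨r.length, ?_, by rw [← List.prefix_iff_eq_take.1 hrs]⟩
        exact lt_of_le_of_ne hrs.length_le fun h => hne (by rw [hrs.eq_of_length h])
      · rintro ⟨i, hi, rfl⟩
        refine ⟨⟨_, rfl⟩, e.prefix_map (List.take_prefix _ _), fun h => ?_⟩
        have := congrArg List.length (e.injective h)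
        simp at this
        omega
    rw [this, Set.InjOn.ncard_image, Set.ncard_coe_finset, Finset.card_range]
    intro i hi j hj hij
    have := congrArg List.length (e.injective hij)
    simp at hi hj this
    omega
  ext x
  constructor
  · rintro ⟨⟨s, rfl⟩, hs⟩
    rw [hcard] at hs
    exact ⟨s, hs, rfl⟩
  · rintro ⟨s, hs, rfl⟩
    exact ⟨⟨s, rfl⟩, by rwa [hcard]⟩

theorem exists_eq_mul_of_range_subset {e e' : StrongEmb} (h : Set.range e' ⊆ Set.range e) :
    ∃ f, e' = e * f := by
  choose f hf using fun s => h ⟨s, rfl⟩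
  refine ⟨⟨f, fun s t hst => ?_, fun s b => ?_⟩, ext fun s => (hf s).symm⟩
  · rw [← e.length_eq_iff, hf, hf, e'.length_eq hst]
  · rw [← e.append_prefix_iff, hf, hf]
    exact e'.append_prefix s b

theorem mem_fixing_of_subset_range {f : StrongEmb} {k : ℕ}
    (h : {s : List Bool | s.length < k} ⊆ Set.range f) : f ∈ fixing k := by
  have hlen : ∀ m (s : List Bool), s.length = m → m < k → (f s).length = m ∧ f s = s := by
    intro m
    induction m using Nat.strong_induction_on with
    | _ m ih =>
      intro s hs hm
      have hl : (f s).length = m := by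
        obtain ⟨t, rfl⟩ := h (show s.length < k from hs.trans_lt hm)
        rcases (hs ▸ f.length_le t).lt_or_eq with hlt | heq
        · have := (ih _ hlt t rfl (hlt.trans hm)).1
          omega
        · rw [f.length_eq (hs.trans heq.symm), hs]
      refine ⟨hl, ?_⟩
      rcases List.eq_nil_or_concat s with rfl | ⟨t, b, rfl⟩
      · simp at hs
        exact List.length_eq_zero_iff.1 (hl.trans hs.symm)
      · have h1 := f.append_prefix t b
        simp only [List.concat_eq_append, List.length_append, List.length_singleton] at hs hl ⊢
        rw [(ih t.length (by omega) t rfl (by omega)).2] at h1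
        exact (h1.eq_of_length (by simp [hl, hs])).symm
  exact fun s hs => (hlen _ s rfl hs).2

theorem exists_range_eq {T : Set (List Bool)} (hT : IsInfStrongTree T) :
    ∃ e : StrongEmb, Set.range e = T := by
  obtain ⟨L, hL, ⟨x₀, hx₀⟩, hTL, hLT, hsplit, hLs, -⟩ := hT
  have hTd : ∀ x ∈ T, x ∈ downcl T := fun x hx => ⟨x, hx, List.prefix_rfl⟩
  have hdd : ∀ x ∈ downcl T, ∀ y, y <+: x → y ∈ downcl T := by
    rintro x ⟨t, ht, hx⟩ y hy
    exact ⟨t, ht, hy.trans hx⟩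
  have huniq : ∀ p x y : List Bool, x ∈ T → y ∈ T → x.length = y.length → p <+: x → p <+: y →
      (∀ l ∈ L, p.length ≤ l → x.length ≤ l) → x = y := by
    intro p x y hx hy hxy hpx hpy hl
    rcases List.prefix_or_prefix_or_exists_branch x y with h | h | ⟨r, b, c, hbc, hrx, hry⟩
    · exact h.eq_of_length hxy
    · exact (h.eq_of_length hxy.symm).symm
    exfalso
    have hpr : p.length ≤ r.length := by
      by_contra! hlt
      exact hbc (List.eq_of_append_singleton_prefix
        (List.prefix_of_prefix_length_le hrx hpx (by simpa using hlt))
        (List.prefix_of_prefix_length_le hry hpy (by simpa using hlt)))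
    have hrb := hdd _ (hTd _ hx) _ hrx
    have hrc := hdd _ (hTd _ hy) _ hry
    have hrL : r.length ∈ L := by
      refine hLs r (hdd _ (hTd _ hx) _ ((List.prefix_append _ _).trans hrx)) ?_
      cases b <;> cases c <;> first | exact absurd rfl hbc | exact ⟨hrb, hrc⟩ | exact ⟨hrc, hrb⟩
    have h1 := hl _ hrL hpr
    have h2 := hrx.length_le
    simp at h2
    omega
  let N : ℕ → ℕ := fun m => sInf {l ∈ L | m < l}
  have hN : ∀ m, N m ∈ L ∧ m < N m := fun m =>
    Nat.sInf_mem (s := {l ∈ L | m < l}) (hL.exists_gt m)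
  have hNle : ∀ m, ∀ l ∈ L, m < l → N m ≤ l := fun m l hl hm => Nat.sInf_le ⟨hl, hm⟩
  have hnext : ∀ (x : T) (b : Bool), ∃ y : T, x.1 ++ [b] <+: y.1 ∧ y.1.length = N x.1.length := by
    rintro ⟨x, hx⟩ b
    have hxb : x ++ [b] ∈ downcl T := by
      cases b
      exacts [(hsplit x hx).1, (hsplit x hx).2]
    obtain ⟨y, hy, hxy⟩ := hxb
    have hlt : x.length < y.length := by
      have := hxy.length_le
      simp at this
      omega
    have hle := hNle _ _ (hTL y hy) hlt
    have hlen : (y.take (N x.length)).length = N x.length := by simpa using hle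
    refine ⟨⟨y.take (N x.length), hLT _ (hdd _ (hTd _ hy) _ (List.take_prefix _ _))
      (hlen.symm ▸ (hN _).1)⟩, ?_, hlen⟩
    refine List.prefix_of_prefix_length_le hxy (List.take_prefix _ _) ?_
    rw [hlen]
    simpa using (hN x.length).2
  choose nxt hnxt hnxtl using hnext
  have hm : sInf L ∈ L := Nat.sInf_mem ⟨_, hTL _ hx₀⟩
  have htake : ∀ y ∈ T, y.take (sInf L) ∈ T ∧ (y.take (sInf L)).length = sInf L := by
    intro y hy
    have hlen : (y.take (sInf L)).length = sInf L := by simpa using Nat.sInf_le (hTL y hy)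
    exact ⟨hLT _ (hdd _ (hTd _ hy) _ (List.take_prefix _ _)) (hlen.symm ▸ hm), hlen⟩
  let root : T := ⟨x₀.take (sInf L), (htake x₀ hx₀).1⟩
  have hroot : ∀ y ∈ T, root.1 <+: y := by
    intro y hy
    have : root.1 = y.take (sInf L) := huniq [] _ _ root.2 (htake y hy).1
      ((htake x₀ hx₀).2.trans (htake y hy).2.symm) List.nil_prefix List.nil_prefix
      fun l hl _ => (htake x₀ hx₀).2.trans_le (Nat.sInf_le hl)
    rw [this]
    exact List.take_prefix _ _
  let F : List Bool → T := fun s => s.foldl nxt root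
  have hF : ∀ s b, F (s ++ [b]) = nxt (F s) b := fun s b => List.foldl_concat _ _ _ _
  have hFl : ∀ s, (F s).1.length = N^[s.length] root.1.length := by
    intro s
    induction s using List.reverseRecOn with
    | nil => rfl
    | append_singleton s b ih =>
      rw [hF, hnxtl, ih, List.length_append, List.length_singleton, Function.iterate_succ_apply']
  refine ⟨⟨fun s => (F s).1, fun s t hst => by rw [hFl, hFl, hst],
    fun s b => by rw [hF]; exact hnxt _ _⟩, Set.Subset.antisymm ?_ fun y hy => ?_⟩
  · rintro _ ⟨s, rfl⟩
    exact (F s).2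
  · suffices h : ∀ d s, (F s).1 <+: y → y.length ≤ (F s).1.length + d → ∃ s, (F s).1 = y from
      h y.length [] (hroot y hy) (Nat.le_add_left _ _)
    intro d
    induction d with
    | zero => exact fun s hs hl => ⟨s, hs.eq_of_length_le hl⟩
    | succ d ih =>
      intro s hs hl
      rcases hs.length_le.eq_or_lt with heq | hlt
      · exact ⟨s, hs.eq_of_length heq⟩
      obtain ⟨b, hb⟩ := List.exists_append_singleton_prefix_of_lt hs hlt
      have hle := hNle _ _ (hTL y hy) hlt
      have hlen : (y.take (N (F s).1.length)).length = N (F s).1.length := by simpa using hle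
      have hyT : y.take (N (F s).1.length) ∈ T :=
        hLT _ (hdd _ (hTd _ hy) _ (List.take_prefix _ _)) (hlen.symm ▸ (hN _).1)
      have heq : (nxt (F s) b).1 = y.take (N (F s).1.length) := by
        refine huniq _ _ _ (nxt (F s) b).2 hyT ((hnxtl _ _).trans hlen.symm) (hnxt _ _)
          (List.prefix_of_prefix_length_le hb (List.take_prefix _ _) ?_) fun l hl hlb => ?_
        · rw [hlen]
          simpa using (hN (F s).1.length).2
        · rw [hnxtl]
          exact hNle _ _ hl (by simpa using hlb)
      refine ih (s ++ [b]) ?_ ?_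
      · rw [hF, heq]
        exact List.take_prefix _ _
      · rw [hF, hnxtl]
        have := (hN (F s).1.length).2
        omega

/-- The infinite strong subtree parametrized by a strong embedding. -/
def toMSpace (e : StrongEmb) : MSpace := ⟨Set.range e, e.isInfStrongTree_range⟩

theorem toMSpace_surjective : Function.Surjective toMSpace := fun T =>
  (exists_range_eq T.2).imp fun _ he => Subtype.ext he

theorem mul_mem_mbasic (e : StrongEmb) {k : ℕ} {f : StrongEmb} (hf : f ∈ fixing k) :
    (e * f).toMSpace ∈ mbasic (rk k e.toMSpace.1) e.toMSpace := by
  refine ⟨⟨k, ?_⟩, ?_⟩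
  · change rk k (Set.range (e * f)) = rk k (Set.range e)
    rw [rk_range, rk_range]
    exact Set.image_congr fun s hs => by rw [mul_apply, hf s hs]
  · rintro _ ⟨s, rfl⟩
    exact ⟨f s, rfl⟩

theorem exists_fixing_of_mem_mbasic {e : StrongEmb} {k : ℕ} {S : MSpace}
    (hS : S ∈ mbasic (rk k e.toMSpace.1) e.toMSpace) :
    ∃ f ∈ fixing k, (e * f).toMSpace = S := by
  obtain ⟨⟨j, hj⟩, hsub⟩ := hS
  obtain ⟨e', rfl⟩ := toMSpace_surjective S
  obtain ⟨f, rfl⟩ := exists_eq_mul_of_range_subset hsub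
  refine ⟨f, mem_fixing_of_subset_range fun s hs => ?_, rfl⟩
  change rk j (Set.range (e * f)) = rk k (Set.range e) at hj
  rw [rk_range, rk_range] at hj
  obtain ⟨t, -, ht⟩ := hj.symm ▸ Set.mem_image_of_mem e hs
  exact ⟨t, e.injective ht⟩

theorem exists_fixing_of_isOpen {O : Set MSpace} (hO : IsOpen O) {e : StrongEmb}
    (he : e.toMSpace ∈ O) : ∃ k, ∀ f ∈ fixing k, (e * f).toMSpace ∈ O := by
  induction hO with
  | basic B hB =>
    obtain ⟨U, T, L, -, rfl⟩ := hB
    obtain ⟨⟨k, rfl⟩, hT⟩ := he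
    refine ⟨k, fun f hf => ?_⟩
    obtain ⟨⟨j, hj⟩, hsub⟩ := e.mul_mem_mbasic hf
    exact ⟨⟨j, hj⟩, hsub.trans hT⟩
  | univ => exact ⟨0, fun _ _ => trivial⟩
  | inter A B _ _ hA hB =>
    obtain ⟨k, hk⟩ := hA he.1
    obtain ⟨l, hl⟩ := hB he.2
    exact ⟨max k l, fun f hf => ⟨hk f (fixing_antitone (le_max_left _ _) hf),
      hl f (fixing_antitone (le_max_right _ _) hf)⟩⟩
  | sUnion C _ hC =>
    obtain ⟨B, hB, heB⟩ := he
    obtain ⟨k, hk⟩ := hC B hB heB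
    exact ⟨k, fun f hf => ⟨B, hB, hk f hf⟩⟩

theorem exists_fixing_mem_of_dense {O : Set MSpace} (hO : Dense O) (e : StrongEmb) (k : ℕ) :
    ∃ f ∈ fixing k, (e * f).toMSpace ∈ O := by
  have hopen : IsOpen (mbasic (rk (k + 1) e.toMSpace.1) e.toMSpace) := by
    obtain ⟨L, hL⟩ := e.isFinStrongTree_image k
    refine TopologicalSpace.isOpen_generateFrom_of_mem ⟨_, _, L, ?_, rfl⟩
    change IsFinStrongTree (rk (k + 1) (Set.range e)) L
    rwa [rk_range]
  obtain ⟨S, hS, hSO⟩ := hO.inter_open_nonempty _ hopen ⟨_, e.mul_mem_mbasic (one_mem _)⟩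
  obtain ⟨f, hf, rfl⟩ := exists_fixing_of_mem_mbasic hS
  exact ⟨f, fixing_antitone (Nat.le_succ k) hf, hSO⟩

/-- In a nonempty basic set, it suffices to shrink the parametrization of one of its elements. -/
theorem exists_mem_mbasic_of_fixing {Q : Set MSpace → Prop}
    (hQ : ∀ (e : StrongEmb) (k : ℕ), ∃ g ∈ fixing k,
      Q (mbasic (rk k (e * g).toMSpace.1) (e * g).toMSpace))
    {U : Set (List Bool)} {T : MSpace} (hne : (mbasic U T).Nonempty) :
    ∃ S ∈ mbasic U T, Q (mbasic U S) := by
  obtain ⟨S, ⟨k, rfl⟩, hS⟩ := hne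
  obtain ⟨e, rfl⟩ := toMSpace_surjective S
  obtain ⟨g, hg, hQg⟩ := hQ e k
  obtain ⟨⟨j, hj⟩, hsub⟩ := e.mul_mem_mbasic hg
  have hk : rk k (e * g).toMSpace.1 = rk k e.toMSpace.1 := by
    change rk k (Set.range (e * g)) = rk k (Set.range e)
    rw [rk_range, rk_range]
    exact Set.image_congr fun s hs => by rw [mul_apply, hg s hs]
  exact ⟨_, ⟨⟨j, hj⟩, hsub.trans hS⟩, hk ▸ hQg⟩

end StrongEmb

open StrongEmb

theorem IsOpen.isRamseySet {O : Set MSpace} (hO : IsOpen O) : IsRamseySet O := fun _ _ hne =>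
  exists_mem_mbasic_of_fixing (Q := fun B => B ⊆ O ∨ B ∩ O = ∅) (fun e k => by
    obtain ⟨g, hg, h⟩ := exists_fixing_subset_or_disjoint (X := toMSpace ⁻¹' O)
      (fun _ he => exists_fixing_of_isOpen hO he) e k
    refine ⟨g, hg, h.imp (fun h S hS => ?_) fun h => ?_⟩
    · obtain ⟨f, hf, rfl⟩ := exists_fixing_of_mem_mbasic hS
      exact h f hf
    · refine Set.eq_empty_iff_forall_notMem.2 fun S hS => ?_
      obtain ⟨f, hf, rfl⟩ := exists_fixing_of_mem_mbasic hS.1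
      exact h f hf hS.2) hne

theorem IsMeagre.isRamseyNull {X : Set MSpace} (hX : IsMeagre X) : IsRamseyNull X := by
  obtain ⟨C, hCo, hCd, hCc, hCX⟩ := mem_residual_iff.1 hX
  obtain ⟨O, hO⟩ := (hCc.insert Set.univ).exists_eq_range (Set.insert_nonempty _ _)
  have hOo : ∀ i, IsOpen (O i) ∧ Dense (O i) := fun i => by
    rcases Set.mem_insert_iff.1 (hO.symm ▸ Set.mem_range_self i : O i ∈ insert Set.univ C) with h | h
    · exact h ▸ ⟨isOpen_univ, dense_univ⟩
    · exact ⟨hCo _ h, hCd _ h⟩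
  refine fun _ _ hne => exists_mem_mbasic_of_fixing (Q := fun B => B ∩ X = ∅) (fun e k => ?_) hne
  obtain ⟨g, hg, h⟩ := exists_fixing_forall_mem (O := fun i => toMSpace ⁻¹' O i)
    (fun i _ he => exists_fixing_of_isOpen (hOo i).1 he)
    (fun i b k => exists_fixing_mem_of_dense (hOo i).2 b k) e k
  refine ⟨g, hg, Set.eq_empty_iff_forall_notMem.2 fun S hS => ?_⟩
  obtain ⟨f, hf, rfl⟩ := exists_fixing_of_mem_mbasic hS.1
  refine hCX (Set.mem_sInter.2 fun t ht => ?_) hS.2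
  obtain ⟨i, rfl⟩ := hO ▸ Set.mem_insert_of_mem _ ht
  exact h f hf i

theorem BaireMeasurableSet.isRamseySet {X : Set MSpace} (hX : BaireMeasurableSet X) :
    IsRamseySet X := by
  obtain ⟨O, hO, hXO⟩ := hX.residualEq_isOpen
  intro U T hne
  have hM : IsMeagre {S | ¬ (S ∈ X ↔ S ∈ O)} := by
    filter_upwards [Filter.eventuallyEq_set.1 hXO] with S hS
    simpa using hS
  obtain ⟨S, hS, hSM⟩ := hM.isRamseyNull U T hne
  have hself : S ∈ mbasic U S := ⟨hS.1, subset_rfl⟩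
  obtain ⟨R, hR, h⟩ := hO.isRamseySet U S ⟨S, hself⟩
  have hiff : ∀ Q ∈ mbasic U R, Q ∈ X ↔ Q ∈ O := by
    intro Q hQ
    by_contra hn
    exact Set.eq_empty_iff_forall_notMem.1 hSM Q ⟨⟨hQ.1, hQ.2.trans hR.2⟩, hn⟩
  refine ⟨R, ⟨hR.1, hR.2.trans hS.2⟩, h.imp (fun h Q hQ => (hiff Q hQ).2 (h hQ)) fun h => ?_⟩
  exact Set.eq_empty_iff_forall_notMem.2 fun Q hQ =>
    Set.eq_empty_iff_forall_notMem.1 h Q ⟨hQ.1, (hiff Q hQ.1).1 hQ.2⟩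

/-- **Milliken.** The Milliken space of infinite strong subtrees of `2^{<ω}` is a topological
Ramsey space: every subset with the property of Baire is Ramsey, and every meager subset is
Ramsey null. -/
theorem milliken_topological_ramsey_space :
    (∀ X : Set MSpace, BaireMeasurableSet X → IsRamseySet X) ∧
    (∀ X : Set MSpace, IsMeagre X → IsRamseyNull X) :=
  ⟨fun _ h => h.isRamseySet, fun _ h => h.isRamseyNull⟩
end
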